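/- arXiv:1207.3849 — 3 statements merged into one kernel-verified Lean document; each statement's English description precedes it below -/
import Mathlib

section
/- Let v and w be unit vectors in X_W, the topological closure of the three-qubit W SLOCC class, such that p_i(v) = p_i(w) for i = 1,2,3 (equivalently, the one-qubit reduced density matrices of v and w have the same spectra). Then v and w are LU-equivalent. -/
open scoped BigOperators

/-- The three-qubit Hilbert space. -/
abbrev H3 := (Fin 2 × Fin 2 × Fin 2) → ℂ

/-- Squared Hermitian norm of a vector in `H3`. -/
noncomputable def normSq3 (v : H3) : ℝ := ∑ x : Fin 2 × Fin 2 × Fin 2, Complex.normSq (v x)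

/-- First one-qubit reduced density matrix. -/
noncomputable def rho1 (v : H3) : Matrix (Fin 2) (Fin 2) ℂ :=
  Matrix.of fun a a' => ∑ b : Fin 2, ∑ c : Fin 2, v (a, b, c) * star (v (a', b, c))

/-- Second one-qubit reduced density matrix. -/
noncomputable def rho2 (v : H3) : Matrix (Fin 2) (Fin 2) ℂ :=
  Matrix.of fun b b' => ∑ a : Fin 2, ∑ c : Fin 2, v (a, b, c) * star (v (a, b', c))

/-- Third one-qubit reduced density matrix. -/
noncomputable def rho3 (v : H3) : Matrix (Fin 2) (Fin 2) ℂ :=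
  Matrix.of fun c c' => ∑ a : Fin 2, ∑ b : Fin 2, v (a, b, c) * star (v (a, b, c'))

/-- Minimal (real) eigenvalue of a 2×2 complex matrix. -/
noncomputable def minEig (ρ : Matrix (Fin 2) (Fin 2) ℂ) : ℝ :=
  sInf {t : ℝ | (t : ℂ) ∈ spectrum ℂ ρ}

noncomputable def p1 (v : H3) : ℝ := minEig (rho1 v)
noncomputable def p2 (v : H3) : ℝ := minEig (rho2 v)
noncomputable def p3 (v : H3) : ℝ := minEig (rho3 v)

/-- The action of a triple of 2×2 matrices on `H3` by the tensor product. -/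
noncomputable def tensor3 (A1 A2 A3 : Matrix (Fin 2) (Fin 2) ℂ) (v : H3) : H3 :=
  fun x => ∑ a' : Fin 2, ∑ b' : Fin 2, ∑ c' : Fin 2,
    A1 x.1 a' * A2 x.2.1 b' * A3 x.2.2 c' * v (a', b', c')

/-- Local unitary equivalence of three-qubit states. -/
def LUequiv (v w : H3) : Prop :=
  ∃ U1 U2 U3 : Matrix (Fin 2) (Fin 2) ℂ,
    U1 ∈ Matrix.unitaryGroup (Fin 2) ℂ ∧ U2 ∈ Matrix.unitaryGroup (Fin 2) ℂ ∧
    U3 ∈ Matrix.unitaryGroup (Fin 2) ℂ ∧ w = tensor3 U1 U2 U3 v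

/-- The three-qubit W state. -/
noncomputable def wState : H3 := fun x =>
  if (x.1 = 1 ∧ x.2.1 = 0 ∧ x.2.2 = 0) ∨ (x.1 = 0 ∧ x.2.1 = 1 ∧ x.2.2 = 0) ∨
      (x.1 = 0 ∧ x.2.1 = 0 ∧ x.2.2 = 1)
  then ((1 / Real.sqrt 3 : ℝ) : ℂ) else 0

/-- The SLOCC class of the W state. -/
def WClass : Set H3 :=
  {v | ∃ (A1 A2 A3 : Matrix (Fin 2) (Fin 2) ℂ) (l : ℂ),
    A1.det = 1 ∧ A2.det = 1 ∧ A3.det = 1 ∧ l ≠ 0 ∧ v = l • tensor3 A1 A2 A3 wState}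


theorem H3_ext {v w : H3} (h0 : v (0,0,0) = w (0,0,0)) (h1 : v (0,0,1) = w (0,0,1))
    (h2 : v (0,1,0) = w (0,1,0)) (h3 : v (0,1,1) = w (0,1,1)) (h4 : v (1,0,0) = w (1,0,0))
    (h5 : v (1,0,1) = w (1,0,1)) (h6 : v (1,1,0) = w (1,1,0)) (h7 : v (1,1,1) = w (1,1,1)) :
    v = w := by
  funext ⟨i, j, k⟩
  fin_cases i <;> fin_cases j <;> fin_cases k <;> assumption

open Matrix in
theorem tensor3_mul (A1 A2 A3 B1 B2 B3 : Matrix (Fin 2) (Fin 2) ℂ) (v : H3) :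
    tensor3 (A1 * B1) (A2 * B2) (A3 * B3) v = tensor3 A1 A2 A3 (tensor3 B1 B2 B3 v) := by
  funext x
  simp only [tensor3, Matrix.mul_apply, Fin.sum_univ_two]
  ring

theorem tensor3_one (v : H3) : tensor3 1 1 1 v = v := by
  apply H3_ext <;> simp [tensor3, Fin.sum_univ_two]

theorem LUequiv.trans {u v w : H3} (h : LUequiv u v) (h' : LUequiv v w) : LUequiv u w := by
  obtain ⟨U1, U2, U3, h1, h2, h3, rfl⟩ := h
  obtain ⟨V1, V2, V3, k1, k2, k3, rfl⟩ := h'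
  exact ⟨V1 * U1, V2 * U2, V3 * U3, mul_mem k1 h1, mul_mem k2 h2, mul_mem k3 h3,
    (tensor3_mul _ _ _ _ _ _ _).symm⟩

theorem LUequiv.symm {v w : H3} (h : LUequiv v w) : LUequiv w v := by
  obtain ⟨U1, U2, U3, h1, h2, h3, rfl⟩ := h
  refine ⟨star U1, star U2, star U3, Unitary.star_mem h1, Unitary.star_mem h2, Unitary.star_mem h3, ?_⟩
  rw [← tensor3_mul, Matrix.mem_unitaryGroup_iff'.1 h1, Matrix.mem_unitaryGroup_iff'.1 h2,
    Matrix.mem_unitaryGroup_iff'.1 h3, tensor3_one]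

/-- vectors supported on 000, 100, 010, 001 -/
def nf (d a b c : ℂ) : H3 := fun x => ![![![d, c], ![b, 0]], ![![a, 0], ![0, 0]]] x.1 x.2.1 x.2.2

/-- flattenings -/
def fl1 (v : H3) : Matrix (Fin 2) (Fin 2 × Fin 2) ℂ := Matrix.of fun a y => v (a, y.1, y.2)
def fl2 (v : H3) : Matrix (Fin 2) (Fin 2 × Fin 2) ℂ := Matrix.of fun b y => v (y.1, b, y.2)
def fl3 (v : H3) : Matrix (Fin 2) (Fin 2 × Fin 2) ℂ := Matrix.of fun c y => v (y.1, y.2, c)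

theorem rho1_eq (v : H3) : rho1 v = fl1 v * (fl1 v).conjTranspose := by
  ext i j; simp [rho1, fl1, Matrix.mul_apply, Fintype.sum_prod_type]
theorem rho2_eq (v : H3) : rho2 v = fl2 v * (fl2 v).conjTranspose := by
  ext i j; simp [rho2, fl2, Matrix.mul_apply, Fintype.sum_prod_type]
theorem rho3_eq (v : H3) : rho3 v = fl3 v * (fl3 v).conjTranspose := by
  ext i j; simp [rho3, fl3, Matrix.mul_apply, Fintype.sum_prod_type]

open Kronecker in
theorem fl1_tensor (A B C : Matrix (Fin 2) (Fin 2) ℂ) (v : H3) :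
    fl1 (tensor3 A B C v) = A * fl1 v * (B ⊗ₖ C).transpose := by
  ext i j
  simp [fl1, tensor3, Matrix.mul_apply, Fintype.sum_prod_type, Matrix.kroneckerMap_apply]
  ring
open Kronecker in
theorem fl2_tensor (A B C : Matrix (Fin 2) (Fin 2) ℂ) (v : H3) :
    fl2 (tensor3 A B C v) = B * fl2 v * (A ⊗ₖ C).transpose := by
  ext i j
  simp [fl2, tensor3, Matrix.mul_apply, Fintype.sum_prod_type, Matrix.kroneckerMap_apply]
  ring
open Kronecker in
theorem fl3_tensor (A B C : Matrix (Fin 2) (Fin 2) ℂ) (v : H3) :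
    fl3 (tensor3 A B C v) = C * fl3 v * (A ⊗ₖ B).transpose := by
  ext i j
  simp [fl3, tensor3, Matrix.mul_apply, Fintype.sum_prod_type, Matrix.kroneckerMap_apply]
  ring

open Kronecker Matrix in
theorem gram_det {U B C : Matrix (Fin 2) (Fin 2) ℂ} {M : Matrix (Fin 2) (Fin 2 × Fin 2) ℂ}
    (hU : U ∈ Matrix.unitaryGroup (Fin 2) ℂ) (hB : B ∈ Matrix.unitaryGroup (Fin 2) ℂ)
    (hC : C ∈ Matrix.unitaryGroup (Fin 2) ℂ) :
    ((U * M * (B ⊗ₖ C)ᵀ) * (U * M * (B ⊗ₖ C)ᵀ)ᴴ).det = (M * Mᴴ).det ∧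
    ((U * M * (B ⊗ₖ C)ᵀ) * (U * M * (B ⊗ₖ C)ᵀ)ᴴ).trace = (M * Mᴴ).trace := by
  have hK : (B ⊗ₖ C) ∈ Matrix.unitaryGroup _ ℂ := Matrix.kronecker_mem_unitary hB hC
  have hK' : (B ⊗ₖ C)ᵀ * ((B ⊗ₖ C)ᵀ)ᴴ = 1 := by
    have := Matrix.mem_unitaryGroup_iff'.1 hK
    rw [Matrix.star_eq_conjTranspose] at this
    have h2 := congrArg Matrix.transpose this
    rw [Matrix.transpose_mul, Matrix.transpose_one] at h2
    exact h2
  have hU' := Matrix.mem_unitaryGroup_iff'.1 hU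
  rw [Matrix.star_eq_conjTranspose] at hU'
  have e : (U * M * (B ⊗ₖ C)ᵀ) * (U * M * (B ⊗ₖ C)ᵀ)ᴴ = U * (M * Mᴴ) * Uᴴ := by
    rw [Matrix.conjTranspose_mul, Matrix.mul_assoc, ← Matrix.mul_assoc ((B ⊗ₖ C)ᵀ), hK',
      Matrix.one_mul, Matrix.conjTranspose_mul]
    simp only [Matrix.mul_assoc]
  rw [e]
  constructor
  · rw [Matrix.det_mul_comm, ← Matrix.mul_assoc, hU', Matrix.one_mul]
  · rw [Matrix.trace_mul_comm, ← Matrix.mul_assoc, hU', Matrix.one_mul]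

theorem LU_inv {v w : H3} (h : LUequiv v w) :
    (rho1 w).det = (rho1 v).det ∧ (rho2 w).det = (rho2 v).det ∧ (rho3 w).det = (rho3 v).det ∧
    (rho1 w).trace = (rho1 v).trace := by
  obtain ⟨U1, U2, U3, h1, h2, h3, rfl⟩ := h
  simp only [rho1_eq, rho2_eq, rho3_eq, fl1_tensor, fl2_tensor, fl3_tensor]
  exact ⟨(gram_det h1 h2 h3).1, (gram_det h2 h1 h3).1, (gram_det h3 h1 h2).1,
    (gram_det h1 h2 h3).2⟩

theorem tr1 (v : H3) : (rho1 v).trace = (normSq3 v : ℂ) := by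
  simp [rho1, normSq3, Matrix.trace, Fintype.sum_prod_type, Complex.mul_conj]
theorem tr2 (v : H3) : (rho2 v).trace = (normSq3 v : ℂ) := by
  simp [rho2, normSq3, Matrix.trace, Fintype.sum_prod_type, Complex.mul_conj]
  ring
theorem tr3 (v : H3) : (rho3 v).trace = (normSq3 v : ℂ) := by
  simp [rho3, normSq3, Matrix.trace, Fintype.sum_prod_type, Complex.mul_conj]
  ring

theorem minEig_det {A : Matrix (Fin 2) (Fin 2) ℂ} (hA : A.IsHermitian) (ht : A.trace = 1) :
    A.det = (minEig A : ℂ) - (minEig A : ℂ) ^ 2 := by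
  have hmem : minEig A ∈ {t : ℝ | (t : ℂ) ∈ spectrum ℂ A} := by
    apply Set.Nonempty.csInf_mem
    · refine ⟨hA.eigenvalues 0, ?_⟩
      show _ ∈ spectrum ℂ A
      rw [hA.spectrum_eq_image_range]
      exact ⟨_, ⟨0, rfl⟩, rfl⟩
    · exact (Matrix.finite_spectrum A).preimage (Complex.ofReal_injective.injOn)
  have h : (minEig A : ℂ) ∈ spectrum ℂ A := hmem
  rw [Matrix.mem_spectrum_iff_isRoot_charpoly, Matrix.charpoly_fin_two, ht] at h
  simp at h
  linear_combination h

theorem det_of_eq {A B : Matrix (Fin 2) (Fin 2) ℂ} (hA : A.IsHermitian) (ht : A.trace = 1)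
    (hB : B.IsHermitian) (ht' : B.trace = 1) (h : minEig A = minEig B) : A.det = B.det := by
  rw [minEig_det hA ht, minEig_det hB ht', h]

/-- phases -/
theorem exists_phase (z : ℂ) : ∃ e : ℂ, e * star e = 1 ∧ e * z = (‖z‖ : ℂ) := by
  by_cases h : z = 0
  · exact ⟨1, by simp, by simp [h]⟩
  · have hn : (‖z‖ : ℂ) ≠ 0 := by simpa using h
    refine ⟨star z / ‖z‖, ?_, ?_⟩
    · have := Complex.mul_conj' z
      simp
      field_simp
      rw [mul_comm, this]
    · have := Complex.mul_conj' z
      simp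
      field_simp
      rw [mul_comm, this]

theorem diag_unitary {x y : ℂ} (hx : x * star x = 1) (hy : y * star y = 1) :
    !![x, 0; 0, y] ∈ Matrix.unitaryGroup (Fin 2) ℂ := by
  rw [Matrix.mem_unitaryGroup_iff]
  ext i j
  simp at hx hy
  fin_cases i <;> fin_cases j <;> simp [Matrix.mul_apply, Matrix.star_apply, hx, hy]

theorem nf_real (d a b c : ℂ) : LUequiv (nf d a b c) (nf ‖d‖ ‖a‖ ‖b‖ ‖c‖) := by
  obtain ⟨ed, hd, hd'⟩ := exists_phase d
  obtain ⟨ea, ha, ha'⟩ := exists_phase a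
  obtain ⟨eb, hb, hb'⟩ := exists_phase b
  obtain ⟨ec, hc, hc'⟩ := exists_phase c
  refine ⟨!![ed, 0; 0, ea], !![1, 0; 0, eb * star ed], !![1, 0; 0, ec * star ed],
    diag_unitary hd ha, diag_unitary (by simp) ?_, diag_unitary (by simp) ?_, ?_⟩
  · rw [star_mul, star_star]
    linear_combination hb * (ed * star ed) + hd
  · rw [star_mul, star_star]
    linear_combination hc * (ed * star ed) + hd
  · rw [← hd', ← ha', ← hb', ← hc']
    apply H3_ext <;> simp [nf, tensor3, Fin.sum_univ_two]
    · left; simp at hd; linear_combination (-ec) * hd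
    · left; simp at hd; linear_combination (-eb) * hd

/-- killing the lower entry of a column -/
theorem exists_rot (x y : ℂ) : ∃ U ∈ Matrix.unitaryGroup (Fin 2) ℂ, U 1 0 * x + U 1 1 * y = 0 := by
  by_cases h : x = 0 ∧ y = 0
  · exact ⟨1, one_mem _, by simp [h.1, h.2]⟩
  · set N : ℝ := Complex.normSq x + Complex.normSq y with hN
    have hpos : 0 < N := by
      have h1 := Complex.normSq_nonneg x
      have h2 := Complex.normSq_nonneg y
      rcases lt_or_eq_of_le (add_nonneg h1 h2) with h3 | h3
      · exact h3
      · exfalso; apply h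
        constructor
        · exact Complex.normSq_eq_zero.1 (by linarith)
        · exact Complex.normSq_eq_zero.1 (by linarith)
    set r : ℝ := Real.sqrt N with hr
    have hr0 : (r : ℂ) ≠ 0 := by exact_mod_cast (Real.sqrt_pos.2 hpos).ne'
    have hrr : (r : ℂ) * r = x * star x + y * star y := by
      have : (r : ℂ) * r = (N : ℂ) := by
        rw [← Complex.ofReal_mul, Real.mul_self_sqrt hpos.le]
      rw [this, hN]
      simp [Complex.mul_conj]
    simp at hrr
    refine ⟨!![star x / r, star y / r; - y / r, x / r], ?_, ?_⟩
    · rw [Matrix.mem_unitaryGroup_iff]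
      ext i j
      fin_cases i <;> fin_cases j <;> simp [Matrix.mul_apply, Matrix.star_apply]
      · field_simp
        linear_combination -hrr
      · field_simp
        ring
      · field_simp
        ring
      · field_simp
        linear_combination -hrr
    · simp; field_simp; ring

theorem W_sub {v : H3} (hv : v ∈ WClass) : ∃ U1 U2 U3 : Matrix (Fin 2) (Fin 2) ℂ,
    U1 ∈ Matrix.unitaryGroup (Fin 2) ℂ ∧ U2 ∈ Matrix.unitaryGroup (Fin 2) ℂ ∧
    U3 ∈ Matrix.unitaryGroup (Fin 2) ℂ ∧ ∃ d a b c, tensor3 U1 U2 U3 v = nf d a b c := by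
  obtain ⟨A1, A2, A3, l, -, -, -, -, rfl⟩ := hv
  obtain ⟨U1, h1, k1⟩ := exists_rot (A1 0 0) (A1 1 0)
  obtain ⟨U2, h2, k2⟩ := exists_rot (A2 0 0) (A2 1 0)
  obtain ⟨U3, h3, k3⟩ := exists_rot (A3 0 0) (A3 1 0)
  refine ⟨U1, U2, U3, h1, h2, h3, ?_⟩
  have e : tensor3 U1 U2 U3 (l • tensor3 A1 A2 A3 wState) =
      l • tensor3 (U1 * A1) (U2 * A2) (U3 * A3) wState := by
    rw [tensor3_mul]
    funext x
    simp only [tensor3, Pi.smul_apply, smul_eq_mul, Fin.sum_univ_two]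
    ring
  have q1 : (U1 * A1) 1 0 = 0 := by simpa [Matrix.mul_apply] using k1
  have q2 : (U2 * A2) 1 0 = 0 := by simpa [Matrix.mul_apply] using k2
  have q3 : (U3 * A3) 1 0 = 0 := by simpa [Matrix.mul_apply] using k3
  rw [e]
  generalize U1 * A1 = B1 at *
  generalize U2 * A2 = B2 at *
  generalize U3 * A3 = B3 at *
  refine ⟨(l • tensor3 B1 B2 B3 wState) (0, 0, 0), (l • tensor3 B1 B2 B3 wState) (1, 0, 0),
    (l • tensor3 B1 B2 B3 wState) (0, 1, 0), (l • tensor3 B1 B2 B3 wState) (0, 0, 1), ?_⟩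
  apply H3_ext <;> simp [nf, tensor3, wState, Fin.sum_univ_two, q1, q2, q3]

theorem compact_unitary : IsCompact (Matrix.unitaryGroup (Fin 2) ℂ : Set (Matrix (Fin 2) (Fin 2) ℂ)) := by
  have hK : IsCompact (Set.univ.pi fun _ : Fin 2 => Set.univ.pi fun _ : Fin 2 =>
      Metric.closedBall (0 : ℂ) 1) :=
    isCompact_univ_pi fun _ => isCompact_univ_pi fun _ => isCompact_closedBall 0 1
  refine IsCompact.of_isClosed_subset (s := (Set.univ.pi fun _ : Fin 2 => Set.univ.pi fun _ : Fin 2 =>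
      Metric.closedBall (0 : ℂ) 1)) hK ?_ ?_
  · have : (Matrix.unitaryGroup (Fin 2) ℂ : Set (Matrix (Fin 2) (Fin 2) ℂ)) =
        {U | U * star U = 1} := by
      ext U; exact Matrix.mem_unitaryGroup_iff
    rw [this]
    exact isClosed_eq (by fun_prop) continuous_const
  · intro U hU i _ j _
    simpa using entry_norm_bound_of_unitary hU i j

theorem closure_nf {v : H3} (hv : v ∈ closure WClass) : ∃ d a b c : ℝ, 0 ≤ d ∧ 0 ≤ a ∧ 0 ≤ b ∧ 0 ≤ c ∧
    LUequiv v (nf d a b c) := by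
  let G := Matrix.unitaryGroup (Fin 2) ℂ
  have : CompactSpace G := isCompact_iff_compactSpace.1 compact_unitary
  let S : Set ((G × G × G) × H3) := {p |
    tensor3 p.1.1 p.1.2.1 p.1.2.2 p.2 (0, 1, 1) = 0 ∧ tensor3 p.1.1 p.1.2.1 p.1.2.2 p.2 (1, 0, 1) = 0 ∧
    tensor3 p.1.1 p.1.2.1 p.1.2.2 p.2 (1, 1, 0) = 0 ∧ tensor3 p.1.1 p.1.2.1 p.1.2.2 p.2 (1, 1, 1) = 0}
  have hc : ∀ x, Continuous fun p : (G × G × G) × H3 =>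
      tensor3 p.1.1 p.1.2.1 p.1.2.2 p.2 x := by
    intro x
    have hm : ∀ i j : Fin 2, Continuous fun U : G => (U : Matrix (Fin 2) (Fin 2) ℂ) i j :=
      fun i j => continuous_subtype_val.matrix_elem i j
    unfold tensor3
    refine continuous_finsetSum _ fun i _ => continuous_finsetSum _ fun j _ =>
      continuous_finsetSum _ fun k _ => ?_
    refine (((((hm _ _).comp (by fun_prop : Continuous fun p : (G × G × G) × H3 => p.1.1)).mul
      ((hm _ _).comp (by fun_prop : Continuous fun p : (G × G × G) × H3 => p.1.2.1))).mul
      ((hm _ _).comp (by fun_prop : Continuous fun p : (G × G × G) × H3 => p.1.2.2)))).mul ?_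
    fun_prop
  have hS : IsClosed S :=
    (isClosed_eq (hc _) continuous_const).inter ((isClosed_eq (hc _) continuous_const).inter
      ((isClosed_eq (hc _) continuous_const).inter (isClosed_eq (hc _) continuous_const)))
  have hS' : IsClosed (Prod.snd '' S) := isClosedMap_snd_of_compactSpace _ hS
  have hsub : WClass ⊆ Prod.snd '' S := by
    intro u hu
    obtain ⟨U1, U2, U3, h1, h2, h3, d, a, b, c, h⟩ := W_sub hu
    refine ⟨((⟨U1, h1⟩, ⟨U2, h2⟩, ⟨U3, h3⟩), u), ?_, rfl⟩
    simp [S, h, nf]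
  obtain ⟨⟨⟨U1, U2, U3⟩, u⟩, hu, rfl⟩ := closure_minimal hsub hS' hv
  obtain ⟨e1, e2, e3, e4⟩ := hu
  have hLU : LUequiv u (tensor3 U1 U2 U3 u) := ⟨U1, U2, U3, U1.2, U2.2, U3.2, rfl⟩
  simp only at e1 e2 e3 e4
  have : tensor3 U1 U2 U3 u = nf (tensor3 U1 U2 U3 u (0,0,0)) (tensor3 U1 U2 U3 u (1,0,0))
      (tensor3 U1 U2 U3 u (0,1,0)) (tensor3 U1 U2 U3 u (0,0,1)) := by
    apply H3_ext <;> simp [nf, e1, e2, e3, e4]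
  rw [this] at hLU
  exact ⟨_, _, _, _, norm_nonneg _, norm_nonneg _, norm_nonneg _, norm_nonneg _,
    hLU.trans (nf_real _ _ _ _)⟩

theorem nf_inv (d a b c : ℝ) :
    (rho1 (nf d a b c)).det = ((a^2 * (b^2 + c^2) : ℝ) : ℂ) ∧
    (rho2 (nf d a b c)).det = ((b^2 * (a^2 + c^2) : ℝ) : ℂ) ∧
    (rho3 (nf d a b c)).det = ((c^2 * (a^2 + b^2) : ℝ) : ℂ) ∧
    (rho1 (nf d a b c)).trace = ((d^2 + a^2 + b^2 + c^2 : ℝ) : ℂ) := by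
  refine ⟨?_, ?_, ?_, ?_⟩ <;>
  simp [rho1, rho2, rho3, nf, Matrix.det_fin_two, Matrix.trace_fin_two] <;> ring

open Matrix in
theorem transpose_unitary {W : Matrix (Fin 2) (Fin 2) ℂ} (hW : W * Wᴴ = 1) :
    Wᵀ ∈ Matrix.unitaryGroup (Fin 2) ℂ := by
  rw [Matrix.mem_unitaryGroup_iff', star_eq_conjTranspose]
  have h2 := congrArg Matrix.transpose hW
  rw [Matrix.transpose_mul, Matrix.transpose_one] at h2
  exact h2

theorem herm_aux {P Q : Matrix (Fin 2) (Fin 2) ℂ} (hP : P ∈ Matrix.unitaryGroup (Fin 2) ℂ)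
    (hQ : Q ∈ Matrix.unitaryGroup (Fin 2) ℂ) (D A B : Matrix (Fin 2) (Fin 2) ℂ)
    (sA : A = P * D * star P) (sB : B = Q * D * star Q) :
    ∃ U ∈ Matrix.unitaryGroup (Fin 2) ℂ, B = U * A * star U := by
  refine ⟨Q * star P, mul_mem hQ (Unitary.star_mem hP), ?_⟩
  have hP' : star P * P = 1 := Matrix.mem_unitaryGroup_iff'.1 hP
  rw [sA, sB, star_mul, star_star]
  calc Q * D * star Q
    _ = Q * 1 * D * 1 * star Q := by simp
    _ = _ := by rw [← hP']; simp only [Matrix.mul_assoc]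

open Matrix in
theorem herm_conj {A B : Matrix (Fin 2) (Fin 2) ℂ} (hA : A.IsHermitian) (hB : B.IsHermitian)
    (h : A.charpoly = B.charpoly) : ∃ U ∈ Matrix.unitaryGroup (Fin 2) ℂ, B = U * A * star U := by
  have he := (hA.eigenvalues_eq_eigenvalues_iff hB).2 h
  have sA := hA.spectral_theorem
  have sB := hB.spectral_theorem
  rw [← he] at sB
  rw [Unitary.conjStarAlgAut_apply] at sA sB
  exact herm_aux hA.eigenvectorUnitary.2 hB.eigenvectorUnitary.2 _ _ _ sA sB

open Matrix in
theorem bip {M N : Matrix (Fin 2) (Fin 2) ℂ} (hM : M.det ≠ 0) (hdet : (M * Mᴴ).det = (N * Nᴴ).det)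
    (htr : (M * Mᴴ).trace = (N * Nᴴ).trace) :
    ∃ U ∈ Matrix.unitaryGroup (Fin 2) ℂ, ∃ V ∈ Matrix.unitaryGroup (Fin 2) ℂ, N = U * M * Vᵀ := by
  obtain ⟨U, hU, h⟩ := herm_conj (isHermitian_mul_conjTranspose_self M)
    (isHermitian_mul_conjTranspose_self N)
    (by rw [Matrix.charpoly_fin_two, Matrix.charpoly_fin_two, hdet, htr])
  have hUU := Matrix.mem_unitaryGroup_iff'.1 hU
  have hUU' := Matrix.mem_unitaryGroup_iff.1 hU
  have hMu : IsUnit M.det := isUnit_iff_ne_zero.2 hM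
  rw [star_eq_conjTranspose] at h hUU hUU'
  refine ⟨U, hU, (M⁻¹ * Uᴴ * N)ᵀ, ?_, ?_⟩
  · have hW : (M⁻¹ * Uᴴ * N) * (M⁻¹ * Uᴴ * N)ᴴ = 1 := by
      calc (M⁻¹ * Uᴴ * N) * (M⁻¹ * Uᴴ * N)ᴴ = M⁻¹ * Uᴴ * (N * Nᴴ) * (U * (M⁻¹)ᴴ) := by
            simp [Matrix.conjTranspose_mul, Matrix.mul_assoc]
        _ = M⁻¹ * (Uᴴ * U) * M * (Mᴴ * (Uᴴ * U) * (M⁻¹)ᴴ) := by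
            rw [h]; simp only [Matrix.mul_assoc]
        _ = 1 := by
            rw [hUU, Matrix.mul_one, Matrix.mul_one, Matrix.nonsing_inv_mul _ hMu,
              ← Matrix.conjTranspose_mul, Matrix.nonsing_inv_mul _ hMu]; simp
    exact transpose_unitary hW
  · rw [Matrix.transpose_transpose]
    calc N = (U * Uᴴ) * N := by rw [hUU', Matrix.one_mul]
      _ = U * (M * M⁻¹) * Uᴴ * N := by rw [Matrix.mul_nonsing_inv _ hMu, Matrix.mul_one]
      _ = _ := by simp only [Matrix.mul_assoc]

theorem bip' {d b c d' b' c' : ℝ} (hb : b ≠ 0) (hc : c ≠ 0) (h : b^2 * c^2 = b'^2 * c'^2)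
    (h' : d^2 + b^2 + c^2 = d'^2 + b'^2 + c'^2) :
    ∃ U ∈ Matrix.unitaryGroup (Fin 2) ℂ, ∃ V ∈ Matrix.unitaryGroup (Fin 2) ℂ,
      ((d' : ℂ) = U 0 0 * V 0 0 * d + U 0 0 * V 0 1 * c + U 0 1 * V 0 0 * b) ∧
      ((c' : ℂ) = U 0 0 * V 1 0 * d + U 0 0 * V 1 1 * c + U 0 1 * V 1 0 * b) ∧
      ((b' : ℂ) = U 1 0 * V 0 0 * d + U 1 0 * V 0 1 * c + U 1 1 * V 0 0 * b) ∧
      (0 = U 1 0 * V 1 0 * d + U 1 0 * V 1 1 * c + U 1 1 * V 1 0 * b) := by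
  have hC : (b:ℂ)^2 * c^2 = b'^2 * c'^2 := by exact_mod_cast h
  have hC' : (d:ℂ)^2 + b^2 + c^2 = d'^2 + b'^2 + c'^2 := by exact_mod_cast h'
  obtain ⟨U, hU, V, hV, e⟩ := bip (M := !![(d:ℂ), c; b, 0]) (N := !![(d':ℂ), c'; b', 0])
    (by simp [Matrix.det_fin_two, hb, hc])
    (by simp [Matrix.det_fin_two, Matrix.mul_apply, Matrix.vecMul, dotProduct]; linear_combination hC)
    (by simp [Matrix.trace_fin_two, Matrix.mul_apply, Matrix.vecMul, dotProduct]; linear_combination hC')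
  refine ⟨U, hU, V, hV, ?_, ?_, ?_, ?_⟩
  · have := congrFun (congrFun e 0) 0
    simp [Matrix.mul_apply] at this
    rw [this]; ring
  · have := congrFun (congrFun e 0) 1
    simp [Matrix.mul_apply] at this
    rw [this]; ring
  · have := congrFun (congrFun e 1) 0
    simp [Matrix.mul_apply] at this
    rw [this]; ring
  · have := congrFun (congrFun e 1) 1
    simp [Matrix.mul_apply] at this
    rw [this]; ring

theorem case_a {d b c d' b' c' : ℝ} (hb : b ≠ 0) (hc : c ≠ 0) (h : b^2 * c^2 = b'^2 * c'^2)
    (h' : d^2 + b^2 + c^2 = d'^2 + b'^2 + c'^2) : LUequiv (nf d 0 b c) (nf d' 0 b' c') := by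
  obtain ⟨U, hU, V, hV, e1, e2, e3, e4⟩ := bip' hb hc h h'
  refine ⟨1, U, V, one_mem _, hU, hV, ?_⟩
  apply H3_ext <;> simp [nf, tensor3, Fin.sum_univ_two]
  · rw [e1]
  · rw [e2]
  · rw [e3]
  · rw [← e4]

theorem case_b {d b c d' b' c' : ℝ} (hb : b ≠ 0) (hc : c ≠ 0) (h : b^2 * c^2 = b'^2 * c'^2)
    (h' : d^2 + b^2 + c^2 = d'^2 + b'^2 + c'^2) : LUequiv (nf d b 0 c) (nf d' b' 0 c') := by
  obtain ⟨U, hU, V, hV, e1, e2, e3, e4⟩ := bip' hb hc h h'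
  refine ⟨U, 1, V, hU, one_mem _, hV, ?_⟩
  apply H3_ext <;> simp [nf, tensor3, Fin.sum_univ_two]
  · rw [e1]
  · rw [e2]
  · rw [e3]
  · rw [← e4]

theorem case_c {d b c d' b' c' : ℝ} (hb : b ≠ 0) (hc : c ≠ 0) (h : b^2 * c^2 = b'^2 * c'^2)
    (h' : d^2 + b^2 + c^2 = d'^2 + b'^2 + c'^2) : LUequiv (nf d b c 0) (nf d' b' c' 0) := by
  obtain ⟨U, hU, V, hV, e1, e2, e3, e4⟩ := bip' hb hc h h'
  refine ⟨U, V, 1, hU, hV, one_mem _, ?_⟩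
  apply H3_ext <;> simp [nf, tensor3, Fin.sum_univ_two]
  · rw [e1]
  · rw [e2]
  · rw [e3]
  · rw [← e4]

theorem rot_mem {d a : ℝ} (h : d^2 + a^2 = 1) :
    !![(d:ℂ), a; -a, d] ∈ Matrix.unitaryGroup (Fin 2) ℂ := by
  have hC : (d:ℂ)^2 + a^2 = 1 := by exact_mod_cast h
  rw [Matrix.mem_unitaryGroup_iff]
  ext i j
  fin_cases i <;> fin_cases j <;> simp [Matrix.mul_apply, Matrix.star_apply]
  · linear_combination hC
  · ring
  · ring
  · linear_combination hC

theorem case_prod {d a b c : ℝ} (h : d^2 + a^2 + b^2 + c^2 = 1) (h1 : a * b = 0) (h2 : a * c = 0)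
    (h3 : b * c = 0) : LUequiv (nf d a b c) (nf 1 0 0 0) := by
  have key : (b = 0 ∧ c = 0) ∨ (a = 0 ∧ c = 0) ∨ (a = 0 ∧ b = 0) := by
    rcases mul_eq_zero.1 h1 with k1 | k1 <;> rcases mul_eq_zero.1 h2 with k2 | k2 <;>
      rcases mul_eq_zero.1 h3 with k3 | k3 <;> tauto
  have hC : (d:ℂ)^2 + a^2 + b^2 + c^2 = 1 := by exact_mod_cast h
  rcases key with ⟨rfl, rfl⟩ | ⟨rfl, rfl⟩ | ⟨rfl, rfl⟩
  · refine ⟨_, 1, 1, rot_mem (d := d) (a := a) (by linarith), one_mem _, one_mem _, ?_⟩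
    apply H3_ext <;> simp [nf, tensor3, Fin.sum_univ_two]
    · simp at hC; linear_combination -hC
    · ring
  · refine ⟨1, _, 1, one_mem _, rot_mem (d := d) (a := b) (by linarith), one_mem _, ?_⟩
    apply H3_ext <;> simp [nf, tensor3, Fin.sum_univ_two]
    · simp at hC; linear_combination -hC
    · ring
  · refine ⟨1, 1, _, one_mem _, one_mem _, rot_mem (d := d) (a := c) (by linarith), ?_⟩
    apply H3_ext <;> simp [nf, tensor3, Fin.sum_univ_two]
    · simp at hC; linear_combination -hC
    · ring

theorem nf_refl (v : H3) : LUequiv v v :=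
  ⟨1, 1, 1, one_mem _, one_mem _, one_mem _, (tensor3_one v).symm⟩

theorem eq_of_prods {a b c a' b' c' : ℝ} (ha : 0 ≤ a) (ha' : 0 ≤ a')
    (h1 : a * b = a' * b') (h2 : a * c = a' * c') (h3 : b * c = b' * c') (h : b * c ≠ 0) :
    a = a' := by
  have : a^2 * (b * c) = a'^2 * (b * c) := by
    calc a^2 * (b * c) = (a * b) * (a * c) := by ring
      _ = a'^2 * (b' * c') := by rw [h1, h2]; ring
      _ = _ := by rw [h3]
  exact (sq_eq_sq₀ ha ha').1 (mul_right_cancel₀ h this)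

theorem nf_main {d a b c d' a' b' c' : ℝ} (hd : 0 ≤ d) (ha : 0 ≤ a) (hb : 0 ≤ b) (hc : 0 ≤ c)
    (hd' : 0 ≤ d') (ha' : 0 ≤ a') (hb' : 0 ≤ b') (hc' : 0 ≤ c')
    (h : d^2 + a^2 + b^2 + c^2 = 1) (h' : d'^2 + a'^2 + b'^2 + c'^2 = 1)
    (h1 : a * b = a' * b') (h2 : a * c = a' * c') (h3 : b * c = b' * c') :
    LUequiv (nf d a b c) (nf d' a' b' c') := by
  by_cases k1 : a = 0
  · by_cases k3 : b * c = 0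
    · exact (case_prod h (by simp [k1]) (by simp [k1]) k3).trans
        (case_prod h' (by rw [← h1, k1, zero_mul]) (by rw [← h2, k1, zero_mul])
          (by rw [← h3, k3])).symm
    · have hb0 : b' ≠ 0 := by rintro rfl; exact k3 (by simpa using h3)
      have k1' : a' = 0 := by
        rw [k1, zero_mul] at h1
        exact (mul_eq_zero.1 h1.symm).resolve_right hb0
      subst k1 k1'
      exact case_a (left_ne_zero_of_mul k3) (right_ne_zero_of_mul k3)
        (by rw [← mul_pow, ← mul_pow, h3]) (by linarith)
  by_cases k2 : b = 0
  · by_cases k3 : a * c = 0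
    · exact (case_prod h (by simp [k2]) k3 (by simp [k2])).trans
        (case_prod h' (by rw [← h1, k2, mul_zero]) (by rw [← h2, k3])
          (by rw [← h3, k2, zero_mul])).symm
    · have hb0 : a' ≠ 0 := by rintro rfl; exact k3 (by simpa using h2)
      have k1' : b' = 0 := by
        rw [k2, mul_zero] at h1
        exact (mul_eq_zero.1 h1.symm).resolve_left hb0
      subst k2 k1'
      exact case_b (left_ne_zero_of_mul k3) (right_ne_zero_of_mul k3)
        (by rw [← mul_pow, ← mul_pow, h2]) (by linarith)
  by_cases k3 : c = 0
  · have hab : a' * b' ≠ 0 := by rw [← h1]; exact mul_ne_zero k1 k2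
    have k3' : c' = 0 := by
      rw [k3, mul_zero] at h2
      exact (mul_eq_zero.1 h2.symm).resolve_left (left_ne_zero_of_mul hab)
    subst k3 k3'
    exact case_c k1 k2 (by rw [← mul_pow, ← mul_pow, h1]) (by linarith)
  have e1 : a = a' := eq_of_prods ha ha' h1 h2 h3 (mul_ne_zero k2 k3)
  have e2 : b = b' := by subst e1; exact mul_left_cancel₀ k1 h1
  have e3 : c = c' := by subst e1; exact mul_left_cancel₀ k1 h2
  subst e1 e2 e3
  have e4 : d = d' := (sq_eq_sq₀ hd hd').1 (by linarith)
  subst e4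
  exact nf_refl _

/-- Unit vectors in the closure `X_W` of the three-qubit W SLOCC class
with the same one-qubit reduced spectra are LU-equivalent. -/
theorem unit_vectors_in_W_closure_with_equal_local_spectra_are_LU_equivalent
    (v w : H3) (hv : v ∈ closure WClass) (hw : w ∈ closure WClass)
    (hvu : normSq3 v = 1) (hwu : normSq3 w = 1)
    (h1 : p1 v = p1 w) (h2 : p2 v = p2 w) (h3 : p3 v = p3 w) :
    LUequiv v w := by

  obtain ⟨d, a, b, c, hd, ha, hb, hc, hL⟩ := closure_nf hv
  obtain ⟨d', a', b', c', hd', ha', hb', hc', hL'⟩ := closure_nf hw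
  obtain ⟨i1, i2, i3, i4⟩ := LU_inv hL
  obtain ⟨j1, j2, j3, j4⟩ := LU_inv hL'
  obtain ⟨m1, m2, m3, m4⟩ := nf_inv d a b c
  obtain ⟨n1, n2, n3, n4⟩ := nf_inv d' a' b' c'
  have H1 : ∀ v, (rho1 v).IsHermitian := fun v => by
    rw [rho1_eq]; exact Matrix.isHermitian_mul_conjTranspose_self _
  have H2 : ∀ v, (rho2 v).IsHermitian := fun v => by
    rw [rho2_eq]; exact Matrix.isHermitian_mul_conjTranspose_self _
  have H3' : ∀ v, (rho3 v).IsHermitian := fun v => by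
    rw [rho3_eq]; exact Matrix.isHermitian_mul_conjTranspose_self _
  have q1 := det_of_eq (H1 v) (by rw [tr1, hvu]; simp) (H1 w) (by rw [tr1, hwu]; simp) h1
  have q2 := det_of_eq (H2 v) (by rw [tr2, hvu]; simp) (H2 w) (by rw [tr2, hwu]; simp) h2
  have q3 := det_of_eq (H3' v) (by rw [tr3, hvu]; simp) (H3' w) (by rw [tr3, hwu]; simp) h3
  rw [← i1, ← j1, m1, n1, Complex.ofReal_inj] at q1
  rw [← i2, ← j2, m2, n2, Complex.ofReal_inj] at q2
  rw [← i3, ← j3, m3, n3, Complex.ofReal_inj] at q3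
  rw [m4, tr1, hvu, Complex.ofReal_inj] at i4
  rw [n4, tr1, hwu, Complex.ofReal_inj] at j4
  refine (hL.trans (nf_main hd ha hb hc hd' ha' hb' hc' i4 j4 ?_ ?_ ?_)).trans hL'.symm
  · exact (sq_eq_sq₀ (by positivity) (by positivity)).1 (by linear_combination (q1 + q2 - q3) / 2)
  · exact (sq_eq_sq₀ (by positivity) (by positivity)).1 (by linear_combination (q1 + q3 - q2) / 2)
  · exact (sq_eq_sq₀ (by positivity) (by positivity)).1 (by linear_combination (q2 + q3 - q1) / 2)
end

section
/- Fix an integer L ≥ 3. Let v and w be unit vectors in H_L that both lie in the SLOCC class of the L-qubit W state (i.e., each equals λ·(A₁⊗⋯⊗A_L)w_L for some A_k ∈ SL(2,ℂ) and λ ∈ ℂ, λ ≠ 0), and suppose that for every k = 1,…,L the 2×2 reduced density matrices ρ_k(v) and ρ_k(w) have the same minimal eigenvalue (equivalently, the same spectra). Then there exist 2×2 unitary matrices U₁,…,U_L with w = (U₁⊗⋯⊗U_L)v. -/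
open scoped BigOperators

/-- The `L`-qubit Hilbert space. -/
abbrev HL (L : ℕ) := (Fin L → Fin 2) → ℂ

/-- Squared Hermitian norm of a vector in `HL L`. -/
noncomputable def normSqL {L : ℕ} (v : HL L) : ℝ := ∑ f : Fin L → Fin 2, Complex.normSq (v f)

/-- The action of an `L`-tuple of 2×2 matrices on `HL L` by the tensor product. -/
noncomputable def tensorL {L : ℕ} (A : Fin L → Matrix (Fin 2) (Fin 2) ℂ) (v : HL L) : HL L :=
  fun f => ∑ g : Fin L → Fin 2, (∏ k, A k (f k) (g k)) * v g

/-- The `k`-th one-qubit reduced density matrix of `v : HL L`. -/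
noncomputable def rhoL {L : ℕ} (k : Fin L) (v : HL L) : Matrix (Fin 2) (Fin 2) ℂ :=
  Matrix.of fun a a' => ∑ f : Fin L → Fin 2,
    if f k = a then v f * star (v (Function.update f k a')) else 0

/-- The `L`-qubit W state. -/
noncomputable def wL (L : ℕ) : HL L := fun f =>
  if ∃ k : Fin L, f = Function.update (fun _ => 0) k 1
  then ((1 / Real.sqrt L : ℝ) : ℂ) else 0

/-- The SLOCC class of the `L`-qubit W state. -/
def WClassL (L : ℕ) : Set (HL L) :=
  {v | ∃ (A : Fin L → Matrix (Fin 2) (Fin 2) ℂ) (l : ℂ),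
    (∀ k, (A k).det = 1) ∧ l ≠ 0 ∧ v = l • tensorL A (wL L)}

theorem cmpaux (S T a b c d : ℝ) (hS : 0 < S) (hST : S < T) (ha : 0 < a) (hb : 0 < b) (hc : 0 < c) (hd : 0 < d)
  (ha2 : 2*a ≤ S) (hb2 : 2*b ≤ T) (hc2 : 2*c ≤ S) (hd2 : 2*d ≤ T)
  (h1 : a*(S-a) = b*(T-b)) (h2 : c*(S-c) = d*(T-d)) (hbd : b < d) : d*a < b*c := by
  have hba : b < a := by
    by_contra h; push Not at h
    nlinarith [mul_pos hb (sub_pos.2 hST), mul_nonneg (sub_nonneg.2 h) (by linarith : 0 ≤ T - a - b)]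
  have hdc : d < c := by
    by_contra h; push Not at h
    nlinarith [mul_pos hd (sub_pos.2 hST), mul_nonneg (sub_nonneg.2 h) (by linarith : 0 ≤ T - c - d)]
  have hac : a < c := by
    by_contra h; push Not at h
    nlinarith [mul_pos (sub_pos.2 hbd) (by linarith : 0 < T - b - d), mul_nonneg (sub_nonneg.2 h) (by linarith : 0 ≤ S - a - c)]
  by_contra h; push Not at h
  obtain ⟨r, rfl⟩ : ∃ r, b = r * a := ⟨b / a, by field_simp⟩
  obtain ⟨s, rfl⟩ : ∃ s, d = s * c := ⟨d / c, by field_simp⟩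
  have hr : r < 1 := by nlinarith
  have hs : s < 1 := by nlinarith
  have hr0 : 0 < r := by by_contra h'; nlinarith
  have hs0 : 0 < s := by by_contra h'; nlinarith
  have hrs : r ≤ s := by
    have : 0 < a * c := by positivity
    by_contra h'; nlinarith
  have e1 : a * (1 - r^2) = S - r * T := by
    have : a * (a * (1 - r^2)) = a * (S - r * T) := by linarith
    exact mul_left_cancel₀ ha.ne' this
  have e2 : c * (1 - s^2) = S - s * T := by
    have : c * (c * (1 - s^2)) = c * (S - s * T) := by linarith
    exact mul_left_cancel₀ hc.ne' this
  have e3 : (a - c) * ((1 - r^2) * (1 - s^2)) = (s - r) * (T * (1 + r * s) - S * (r + s)) := by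
    linear_combination (1 - s^2) * e1 - (1 - r^2) * e2
  have h4 : 0 < T * (1 + r * s) - S * (r + s) := by
    have := mul_pos (sub_pos.2 hr) (sub_pos.2 hs)
    nlinarith
  have h5 : 0 < (1 - r^2) * (1 - s^2) := by
    apply mul_pos <;> nlinarith
  have h6 := mul_nonneg (sub_nonneg.2 hrs) h4.le
  nlinarith

theorem exists_third {ι : Type*} [Fintype ι] [DecidableEq ι] (h3 : 3 ≤ Fintype.card ι) (j k : ι) : ∃ i, i ≠ j ∧ i ≠ k := by
  by_contra h
  push Not at h
  have : (Finset.univ : Finset ι) ⊆ {j, k} := by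
    intro i _
    by_cases hi : i = j
    · simp [hi]
    · simp [h i hi]
  have := (Finset.card_le_card this).trans Finset.card_le_two
  rw [Finset.card_univ] at this
  omega

theorem two_le_sum {ι : Type*} [Fintype ι] [DecidableEq ι] (a : ι → ℝ) (ha : ∀ k, 0 < a k) {j k : ι} (h : j ≠ k) :
    a j + a k ≤ ∑ i, a i := by
  rw [← Finset.sum_pair h]
  exact Finset.sum_le_sum_of_subset_of_nonneg (Finset.subset_univ _) (fun i _ _ => (ha i).le)

theorem two_lt_sum {ι : Type*} [Fintype ι] [DecidableEq ι] (h3 : 3 ≤ Fintype.card ι)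
    (a : ι → ℝ) (ha : ∀ k, 0 < a k) {j k : ι} (h : j ≠ k) :
    a j + a k < ∑ i, a i := by
  rw [← Finset.sum_pair h]
  obtain ⟨i, hi, hi'⟩ := exists_third h3 j k
  exact Finset.sum_lt_sum_of_subset (Finset.subset_univ _) (Finset.mem_univ i) (by simp [hi, hi'])
    (ha i) (fun i _ _ => (ha i).le)

theorem structaux {ι : Type*} [Fintype ι] [DecidableEq ι] (h3 : 3 ≤ Fintype.card ι)
    (p : ι → ℝ) (hp : ∀ k, 0 < p k) :
    ∃ a : ι → ℝ, (∀ k, 0 < a k) ∧ (∀ k, 2 * a k ≤ ∑ i, p i) ∧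
      (∀ k, a k * (∑ i, p i - a k) = p k * (∑ i, p i - p k)) ∧
      ((∑ i, a i = ∑ i, p i ∧ p = a) ∨
        ∃ k, ∑ i, a i = 2 * a k ∧ p = Function.update a k (∑ i, p i - a k)) := by
  by_cases h : ∀ k, 2 * p k ≤ ∑ i, p i
  · exact ⟨p, hp, h, fun _ => rfl, Or.inl ⟨rfl, rfl⟩⟩
  push Not at h
  obtain ⟨k, hk⟩ := h
  set S := ∑ i, p i with hS
  have hkS : p k < S := by
    obtain ⟨i, hi, _⟩ := exists_third h3 k k
    have := two_le_sum p hp hi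
    linarith [hp i]
  have hsm : ∀ j, j ≠ k → 2 * p j ≤ S := by
    intro j hj
    have := two_le_sum p hp hj
    linarith
  refine ⟨Function.update p k (S - p k), ?_, ?_, ?_, Or.inr ⟨k, ?_, ?_⟩⟩
  · intro j
    by_cases hj : j = k
    · subst hj; simp; exact hkS
    · simp [hj, hp]
  · intro j
    by_cases hj : j = k
    · subst hj; simp; linarith
    · simp [hj, hsm]
  · intro j
    by_cases hj : j = k
    · subst hj; simp; ring
    · simp [hj]
  · rw [Finset.sum_update_of_mem (Finset.mem_univ k)]
    have := Finset.sum_sdiff (f := p) (Finset.subset_univ {k})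
    simp only [Finset.sum_singleton] at this
    simp only [Function.update_self]
    linarith
  · simp

theorem uniq_lt {ι : Type*} [Fintype ι] [DecidableEq ι] (h3 : 3 ≤ Fintype.card ι)
    (p q : ι → ℝ) (hp : ∀ k, 0 < p k) (hq : ∀ k, 0 < q k)
    (h : ∀ k, p k * (∑ i, p i - p k) = q k * (∑ i, q i - q k)) :
    ¬ (∑ i, p i < ∑ i, q i) := by
  intro hST
  obtain ⟨a, ha, ha2, hae, hac⟩ := structaux h3 p hp
  obtain ⟨b, hb, hb2, hbe, hbc⟩ := structaux h3 q hq
  have hne : Nonempty ι := Fintype.card_pos_iff.1 (by omega)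
  have hS : 0 < ∑ i, p i := Finset.sum_pos (fun i _ => hp i) Finset.univ_nonempty
  set S := ∑ i, p i
  set T := ∑ i, q i
  have he : ∀ k, a k * (S - a k) = b k * (T - b k) := fun k => by rw [hae, hbe, h]
  have hba : ∀ k, b k < a k := by
    intro k
    by_contra h'; push Not at h'
    have := hb k; have := ha2 k; have := hb2 k; have := he k
    nlinarith [mul_pos (hb k) (sub_pos.2 hST), mul_nonneg (sub_nonneg.2 h') (by linarith : 0 ≤ T - a k - b k)]
  have haS : ∑ i, a i ≤ S := by
    rcases hac with ⟨h1, _⟩ | ⟨k, h1, _⟩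
    · exact h1.le
    · rw [h1]; exact ha2 k
  rcases hbc with ⟨h1, _⟩ | ⟨k, h1, _⟩
  · have : ∑ i, b i ≤ ∑ i, a i := Finset.sum_le_sum (fun i _ => (hba i).le)
    linarith
  have hlt : ∀ j, j ≠ k → b j < b k := by
    intro j hj
    have := two_lt_sum h3 b hb hj
    linarith
  have hc : ∀ j, j ≠ k → b k * a j < b j * a k := fun j hj =>
    cmpaux S T (a j) (b j) (a k) (b k) hS hST (ha j) (hb j) (ha k) (hb k) (ha2 j) (hb2 j) (ha2 k) (hb2 k)
      (he j) (he k) (hlt j hj)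
  have hsum : ∑ j, b k * a j < ∑ j, b j * a k := by
    apply Finset.sum_lt_sum
    · intro j _
      by_cases hj : j = k
      · rw [hj]
      · exact (hc j hj).le
    · obtain ⟨i, hi, _⟩ := exists_third h3 k k
      exact ⟨i, Finset.mem_univ i, hc i hi⟩
  rw [← Finset.mul_sum, ← Finset.sum_mul, h1] at hsum
  have hlt2 : ∑ i, a i < 2 * a k := by
    have := hb k
    by_contra h'; push Not at h'
    nlinarith
  rcases hac with ⟨h1, _⟩ | ⟨m, h1, _⟩
  · have := ha2 k; linarith
  · by_cases hm : m = k
    · subst hm; linarith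
    · have := two_lt_sum h3 a ha hm
      linarith

theorem uniq {ι : Type*} [Fintype ι] [DecidableEq ι] (h3 : 3 ≤ Fintype.card ι)
    (p q : ι → ℝ) (hp : ∀ k, 0 < p k) (hq : ∀ k, 0 < q k)
    (h : ∀ k, p k * (∑ i, p i - p k) = q k * (∑ i, q i - q k)) : p = q := by
  have hST : ∑ i, p i = ∑ i, q i :=
    le_antisymm (not_lt.1 (uniq_lt h3 q p hq hp (fun k => (h k).symm))) (not_lt.1 (uniq_lt h3 p q hp hq h))
  obtain ⟨a, ha, ha2, hae, hac⟩ := structaux h3 p hp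
  obtain ⟨b, hb, hb2, hbe, hbc⟩ := structaux h3 q hq
  rw [← hST] at hb2 hbe hbc
  simp only [← hST] at h
  set S := ∑ i, p i
  have hab : a = b := by
    funext k
    have e1 : (a k - b k) * (S - a k - b k) = 0 := by
      have := hae k; rw [h k, ← hbe k] at this
      linear_combination this
    have := ha2 k
    have := hb2 k
    rcases mul_eq_zero.1 e1 with h | h <;> linarith
  subst hab
  rcases hac with ⟨h1, h2⟩ | ⟨k, h1, h2⟩ <;> rcases hbc with ⟨h3', h4⟩ | ⟨m, h3', h4⟩
  · rw [h2, h4]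
  · rw [h2, h4, eq_comm, Function.update_eq_self_iff]; linarith
  · rw [h2, h4, Function.update_eq_self_iff]; linarith
  · by_cases hm : m = k
    · subst hm; rw [h2, h4]
    · have := two_lt_sum h3 a ha hm
      linarith
noncomputable def kronL {ι : Type*} [Fintype ι] (A : ι → Matrix (Fin 2) (Fin 2) ℂ) :
    Matrix (ι → Fin 2) (ι → Fin 2) ℂ := Matrix.of fun f g => ∏ k, A k (f k) (g k)

theorem kronL_mul {ι : Type*} [Fintype ι] [DecidableEq ι] (A B : ι → Matrix (Fin 2) (Fin 2) ℂ) :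
    kronL A * kronL B = kronL (fun k => A k * B k) := by
  ext f g
  simp only [kronL, Matrix.mul_apply, Matrix.of_apply]
  rw [Finset.prod_univ_sum, Fintype.piFinset_univ]
  simp only [Finset.prod_mul_distrib]

theorem kronL_one {ι : Type*} [Fintype ι] [DecidableEq ι] :
    kronL (fun _ : ι => (1 : Matrix (Fin 2) (Fin 2) ℂ)) = 1 := by
  ext f g
  simp only [kronL, Matrix.of_apply, Matrix.one_apply]
  by_cases h : f = g
  · simp [h]
  · rw [if_neg h]
    obtain ⟨i, hi⟩ := Function.ne_iff.1 h
    exact Finset.prod_eq_zero (Finset.mem_univ i) (by simp [hi])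

theorem kronL_conjTranspose {ι : Type*} [Fintype ι] (A : ι → Matrix (Fin 2) (Fin 2) ℂ) :
    (kronL A).conjTranspose = kronL (fun k => (A k).conjTranspose) := by
  ext f g
  simp [kronL, Matrix.conjTranspose_apply]

theorem tensorL_eq {L : ℕ} (A : Fin L → Matrix (Fin 2) (Fin 2) ℂ) (v : HL L) :
    tensorL A v = (kronL A).mulVec v := by
  funext f
  simp [tensorL, kronL, Matrix.mulVec, dotProduct]

theorem tensorL_tensorL {L : ℕ} (A B : Fin L → Matrix (Fin 2) (Fin 2) ℂ) (v : HL L) :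
    tensorL A (tensorL B v) = tensorL (fun k => A k * B k) v := by
  simp only [tensorL_eq, Matrix.mulVec_mulVec, kronL_mul]

theorem tensorL_one {L : ℕ} (v : HL L) :
    tensorL (fun _ => 1) v = v := by
  simp only [tensorL_eq, kronL_one, Matrix.one_mulVec]

noncomputable def sliceL {L : ℕ} (k : Fin L) (v : HL L) :
    Matrix (Fin 2) ({j // j ≠ k} → Fin 2) ℂ :=
  Matrix.of fun a h => v ((Equiv.funSplitAt k (Fin 2)).symm (a, h))

theorem rhoL_eq {L : ℕ} (k : Fin L) (v : HL L) :
    rhoL k v = sliceL k v * (sliceL k v).conjTranspose := by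
  ext a a'
  simp only [rhoL, sliceL, Matrix.mul_apply, Matrix.of_apply, Matrix.conjTranspose_apply]
  rw [← (Equiv.funSplitAt k (Fin 2)).symm.sum_comp, Fintype.sum_prod_type, Finset.sum_eq_single a]
  · apply Finset.sum_congr rfl
    intro h _
    rw [if_pos (by simp [Equiv.funSplitAt, Equiv.piSplitAt])]
    congr 3
    funext j
    by_cases hj : j = k
    · subst hj; simp [Equiv.funSplitAt, Equiv.piSplitAt]
    · simp [Equiv.funSplitAt, Equiv.piSplitAt, hj]
  · intro b _ hb
    apply Finset.sum_eq_zero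
    intro h _
    rw [if_neg]
    simpa [Equiv.funSplitAt, Equiv.piSplitAt] using hb
  · simp

theorem sliceL_tensorL {L : ℕ} (k : Fin L) (V : Fin L → Matrix (Fin 2) (Fin 2) ℂ) (v : HL L) :
    sliceL k (tensorL V v) = V k * (sliceL k v * (kronL (fun j : {j // j ≠ k} => V j)).transpose) := by
  ext a h
  simp only [sliceL, tensorL, kronL, Matrix.mul_apply, Matrix.of_apply, Matrix.transpose_apply]
  rw [← (Equiv.funSplitAt k (Fin 2)).symm.sum_comp, Fintype.sum_prod_type]
  apply Finset.sum_congr rfl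
  intro b _
  rw [Finset.mul_sum]
  apply Finset.sum_congr rfl
  intro h' _
  rw [Fintype.prod_eq_mul_prod_subtype_ne _ k]
  have : ∏ j : {j // j ≠ k}, V j ((Equiv.funSplitAt k (Fin 2)).symm (a, h) j) ((Equiv.funSplitAt k (Fin 2)).symm (b, h') j)
     = ∏ j : {j // j ≠ k}, V j (h j) (h' j) := by
    apply Finset.prod_congr rfl
    rintro ⟨j, hj⟩ _
    simp [Equiv.funSplitAt, Equiv.piSplitAt, hj]
  rw [this]
  simp only [Equiv.funSplitAt, Equiv.piSplitAt, Equiv.coe_fn_symm_mk, dif_pos]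
  ring

theorem rhoL_tensorL {L : ℕ} (k : Fin L) (V : Fin L → Matrix (Fin 2) (Fin 2) ℂ)
    (hV : ∀ k, V k ∈ Matrix.unitaryGroup (Fin 2) ℂ) (v : HL L) :
    rhoL k (tensorL V v) = V k * rhoL k v * (V k).conjTranspose := by
  have h1 : (kronL (fun j : {j // j ≠ k} => V j)).conjTranspose * kronL (fun j : {j // j ≠ k} => V j) = 1 := by
    rw [kronL_conjTranspose, kronL_mul, ← kronL_one]
    congr 1
    funext j
    exact Matrix.mem_unitaryGroup_iff'.1 (hV j)
  have h2 := congrArg Matrix.transpose h1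
  rw [Matrix.transpose_mul, Matrix.transpose_one] at h2
  rw [rhoL_eq, rhoL_eq, sliceL_tensorL]
  generalize kronL (fun j : {j // j ≠ k} => V j) = K at *
  have h3 : K.transpose * K.transpose.conjTranspose = 1 := h2
  rw [Matrix.conjTranspose_mul, Matrix.conjTranspose_mul]
  calc V k * (sliceL k v * K.transpose) * (K.transpose.conjTranspose * (sliceL k v).conjTranspose * (V k).conjTranspose)
    _ = V k * (sliceL k v * (K.transpose * K.transpose.conjTranspose) * (sliceL k v).conjTranspose) * (V k).conjTranspose := by
      simp only [Matrix.mul_assoc]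
    _ = _ := by rw [h3, Matrix.mul_one]

theorem det_rhoL_tensorL {L : ℕ} (k : Fin L) (V : Fin L → Matrix (Fin 2) (Fin 2) ℂ)
    (hV : ∀ k, V k ∈ Matrix.unitaryGroup (Fin 2) ℂ) (v : HL L) :
    (rhoL k (tensorL V v)).det = (rhoL k v).det := by
  rw [rhoL_tensorL k V hV, Matrix.det_mul_right_comm, show V k * (V k).conjTranspose = 1 from
    Matrix.mem_unitaryGroup_iff.1 (hV k), Matrix.one_mul]

theorem trace_rhoL_tensorL {L : ℕ} (k : Fin L) (V : Fin L → Matrix (Fin 2) (Fin 2) ℂ)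
    (hV : ∀ k, V k ∈ Matrix.unitaryGroup (Fin 2) ℂ) (v : HL L) :
    (rhoL k (tensorL V v)).trace = (rhoL k v).trace := by
  rw [rhoL_tensorL k V hV, Matrix.trace_mul_comm, ← Matrix.mul_assoc,
    show (V k).conjTranspose * V k = 1 from
    Matrix.mem_unitaryGroup_iff'.1 (hV k), Matrix.one_mul]

theorem trace_rhoL {L : ℕ} (k : Fin L) (v : HL L) :
    (rhoL k v).trace = (normSqL v : ℂ) := by
  simp only [Matrix.trace_fin_two, rhoL, Matrix.of_apply, normSqL, ← Finset.sum_add_distrib]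
  push_cast
  apply Finset.sum_congr rfl
  intro f _
  rw [← Complex.mul_conj]
  have : f k = 0 ∨ f k = 1 := by omega
  rcases this with h | h
  · rw [if_pos h, if_neg (by simp [h]), ← h, Function.update_eq_self]; simp
  · rw [if_neg (by simp [h]), if_pos h, ← h, Function.update_eq_self]; simp

theorem det_rhoL_minEig {L : ℕ} (k : Fin L) (v : HL L) (hv : normSqL v = 1) :
    (rhoL k v).det = (minEig (rhoL k v) : ℂ) - (minEig (rhoL k v) : ℂ) ^ 2 := by
  have hH : (rhoL k v).IsHermitian := by
    rw [rhoL_eq]; exact Matrix.isHermitian_mul_conjTranspose_self _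
  have htr := trace_rhoL k v
  rw [hv] at htr
  generalize rhoL k v = ρ at *
  have hfin : ({t : ℝ | (t : ℂ) ∈ spectrum ℂ ρ}).Finite :=
    (Matrix.finite_spectrum ρ).preimage (Complex.ofReal_injective.injOn)
  have hne : ({t : ℝ | (t : ℂ) ∈ spectrum ℂ ρ}).Nonempty :=
    ⟨hH.eigenvalues 0, by
      have := hH.eigenvalues_mem_spectrum_real 0
      exact this⟩
  have hmem : minEig ρ ∈ {t : ℝ | (t : ℂ) ∈ spectrum ℂ ρ} := hne.csInf_mem hfin
  have h := Matrix.mem_spectrum_iff_isRoot_charpoly.1 hmem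
  rw [Matrix.charpoly_fin_two, Polynomial.IsRoot.def, htr] at h
  simp at h
  linear_combination h

def basisE {L : ℕ} : Option (Fin L) → (Fin L → Fin 2)
  | none => fun _ => 0
  | some k => Function.update (fun _ => 0) k 1

theorem basisE_inj {L : ℕ} : Function.Injective (basisE (L := L)) := by
  rintro (_ | j) (_ | k) h
  · rfl
  · have := congrFun h k; simp [basisE] at this
  · have := congrFun h j; simp [basisE] at this
  · have := congrFun h k
    by_cases hj : k = j
    · rw [hj]
    · simp [basisE, hj] at this

def SuppW {L : ℕ} (v : HL L) : Prop := ∀ f, f ∉ Set.range (basisE (L := L)) → v f = 0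

theorem sum_supp {L : ℕ} {M : Type*} [AddCommMonoid M] (G : (Fin L → Fin 2) → M)
    (hG : ∀ f, f ∉ Set.range (basisE (L := L)) → G f = 0) :
    ∑ f, G f = G (basisE none) + ∑ k, G (basisE (some k)) := by
  rw [← Fintype.sum_of_injective basisE basisE_inj (fun o => G (basisE o)) G hG (fun _ => rfl),
    Fintype.sum_option]

theorem not_range {L : ℕ} {f : Fin L → Fin 2} {j k : Fin L} (hjk : j ≠ k) (hj : f j = 1) (hk : f k = 1) :
    f ∉ Set.range (basisE (L := L)) := by
  rintro ⟨(_ | m), rfl⟩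
  · simp [basisE] at hj
  · by_cases h1 : j = m
    · by_cases h2 : k = m
      · exact hjk (h1.trans h2.symm)
      · simp [basisE, h2] at hk
    · simp [basisE, h1] at hj

theorem two_ones {L : ℕ} {f : Fin L → Fin 2} (hf : f ∉ Set.range (basisE (L := L))) (m : Fin L) :
    ∃ j, j ≠ m ∧ f j = 1 := by
  by_contra h
  push Not at h
  have h0 : ∀ j, j ≠ m → f j = 0 := fun j hj => by have := h j hj; omega
  have : f m = 0 ∨ f m = 1 := by omega
  apply hf
  rcases this with h1 | h1
  · refine ⟨none, ?_⟩
    funext j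
    by_cases hj : j = m
    · rw [hj, h1]; rfl
    · rw [h0 j hj]; rfl
  · refine ⟨some m, ?_⟩
    funext j
    by_cases hj : j = m
    · subst hj; simp [basisE, h1]
    · simp [basisE, hj, h0 j hj]

theorem normSq_supp {L : ℕ} (v : HL L) (hv : SuppW v) :
    normSqL v = Complex.normSq (v (basisE none)) + ∑ k, Complex.normSq (v (basisE (some k))) := by
  rw [normSqL, sum_supp]
  intro f hf
  rw [hv f hf, map_zero]

theorem rhoL_apply_supp {L : ℕ} (v : HL L) (hv : SuppW v) (k : Fin L) (a a' : Fin 2) :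
    rhoL k v a a' = (if (0 : Fin 2) = a then v (basisE none) * star (v (Function.update (basisE none) k a')) else 0)
      + ∑ j, if (basisE (some j) k) = a then v (basisE (some j)) * star (v (Function.update (basisE (some j)) k a')) else 0 := by
  rw [rhoL, Matrix.of_apply, sum_supp]
  · rfl
  · intro f hf
    simp [hv f hf]

theorem det_rhoL_supp {L : ℕ} (v : HL L) (hv : SuppW v) (k : Fin L) :
    (rhoL k v).det = ((Complex.normSq (v (basisE (some k))) *
      (∑ j, Complex.normSq (v (basisE (some j))) - Complex.normSq (v (basisE (some k)))) : ℝ) : ℂ) := by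
  have h11 : rhoL k v 1 1 = v (basisE (some k)) * star (v (basisE (some k))) := by
    rw [rhoL_apply_supp v hv, if_neg (by decide), zero_add, Finset.sum_eq_single k]
    · rw [if_pos (by simp [basisE])]
      simp [basisE]
    · intro j _ hj
      rw [if_neg]
      simp [basisE, hj.symm]
    · simp
  have h10 : rhoL k v 1 0 = v (basisE (some k)) * star (v (basisE none)) := by
    rw [rhoL_apply_supp v hv, if_neg (by decide), zero_add, Finset.sum_eq_single k]
    · rw [if_pos (by simp [basisE])]
      simp [basisE]
    · intro j _ hj
      rw [if_neg]
      simp [basisE, hj.symm]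
    · simp
  have h01 : rhoL k v 0 1 = v (basisE none) * star (v (basisE (some k))) := by
    rw [rhoL_apply_supp v hv, if_pos rfl, Finset.sum_eq_zero, add_zero]
    · simp [basisE]
    · intro j _
      by_cases hj : k = j
      · subst hj; simp [basisE]
      · rw [hv (Function.update (basisE (some j)) k 1)]
        · simp
        · apply not_range (j := j) (k := k) (Ne.symm hj)
          · simp [basisE, Ne.symm hj]
          · simp
  have htr : rhoL k v 0 0 + rhoL k v 1 1 = (normSqL v : ℂ) := by
    rw [← trace_rhoL k v, Matrix.trace_fin_two]
  rw [normSq_supp v hv] at htr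
  rw [Matrix.det_fin_two, eq_sub_of_add_eq htr, h11, h10, h01]
  push_cast
  simp only [← Complex.mul_conj, Complex.star_def]
  ring

theorem qr_fin_two (A : Matrix (Fin 2) (Fin 2) ℂ) (hA : A.det = 1) :
    ∃ U R : Matrix (Fin 2) (Fin 2) ℂ, U ∈ Matrix.unitaryGroup (Fin 2) ℂ ∧ A = U * R ∧
      R 1 0 = 0 ∧ R 0 0 ≠ 0 ∧ R 1 1 ≠ 0 := by
  obtain ⟨a, b, c, d, rfl⟩ : ∃ a b c d, A = !![a, b; c, d] :=
    ⟨A 0 0, A 0 1, A 1 0, A 1 1, Matrix.eta_fin_two A⟩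
  rw [Matrix.det_fin_two_of] at hA
  set s : ℝ := Complex.normSq a + Complex.normSq c with hs
  have hpos : 0 < s := by
    have h1 := Complex.normSq_nonneg a
    have h2 := Complex.normSq_nonneg c
    rcases (add_nonneg h1 h2).lt_or_eq with h | h
    · exact h
    · exfalso
      have ha : a = 0 := Complex.normSq_eq_zero.1 (by linarith)
      have hc : c = 0 := Complex.normSq_eq_zero.1 (by linarith)
      simp [ha, hc] at hA
  have hn : (Real.sqrt s : ℂ) * (Real.sqrt s : ℂ) = a * star a + c * star c := by
    rw [← Complex.ofReal_mul, Real.mul_self_sqrt hpos.le, hs]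
    push_cast
    simp only [← Complex.mul_conj, Complex.star_def]
  have hn0 : (Real.sqrt s : ℂ) ≠ 0 := by
    exact_mod_cast (Real.sqrt_pos.2 hpos).ne'
  have hnr : star (Real.sqrt s : ℂ) = (Real.sqrt s : ℂ) := by simp
  generalize (Real.sqrt s : ℂ) = n at *
  rw [Complex.star_def] at hn
  rw [Complex.star_def] at hnr
  set U : Matrix (Fin 2) (Fin 2) ℂ := !![a / n, -star c / n; c / n, star a / n] with hU
  have hUu : U * star U = 1 := by
    ext i j
    fin_cases i <;> fin_cases j <;>
      simp [hU, Matrix.mul_apply, Fin.sum_univ_two, Matrix.star_apply, hnr] <;>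
      field_simp <;> first | done | ring1 | linear_combination (-1 : ℂ) * hn
  have hUu' : star U * U = 1 := mul_eq_one_comm.1 hUu
  refine ⟨U, star U * !![a, b; c, d], Matrix.mem_unitaryGroup_iff.2 hUu, ?_, ?_, ?_, ?_⟩
  · rw [← Matrix.mul_assoc, hUu, Matrix.one_mul]
  · simp [hU, Matrix.mul_apply, Fin.sum_univ_two, Matrix.star_apply, hnr]
    field_simp
    ring
  · have : (star U * !![a, b; c, d]) 0 0 = n := by
      simp [hU, Matrix.mul_apply, Fin.sum_univ_two, Matrix.star_apply, hnr]
      field_simp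
      linear_combination (-1 : ℂ) * hn
    rw [this]; exact hn0
  · have : (star U * !![a, b; c, d]) 1 1 = 1 / n := by
      simp [hU, Matrix.mul_apply, Fin.sum_univ_two, Matrix.star_apply, hnr]
      field_simp
      linear_combination hA
    rw [this]; exact one_div_ne_zero hn0

theorem normal_form {L : ℕ} (hL : 3 ≤ L) (v : HL L) (hv : v ∈ WClassL L) :
    ∃ (U : Fin L → Matrix (Fin 2) (Fin 2) ℂ) (s : HL L),
      (∀ k, U k ∈ Matrix.unitaryGroup (Fin 2) ℂ) ∧ SuppW s ∧ (∀ k, s (basisE (some k)) ≠ 0) ∧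
      v = tensorL U s := by
  obtain ⟨A, l, hA, hl, rfl⟩ := hv
  choose U R hU hAe h10 h00 h11 using fun k => qr_fin_two (A k) (hA k)
  have hform : ∀ f, tensorL R (wL L) f =
      ∑ m, (∏ j, R j (f j) (basisE (some m) j)) * ((1 / Real.sqrt L : ℝ) : ℂ) := by
    intro f
    rw [tensorL, sum_supp]
    · have h0 : wL L (basisE none) = 0 := by
        rw [wL, if_neg]
        rintro ⟨k, hk⟩
        have := congrFun hk k
        simp [basisE] at this
      rw [h0, mul_zero, zero_add]
      apply Finset.sum_congr rfl
      intro m _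
      rw [wL, if_pos ⟨m, rfl⟩]
    · intro g hg
      rw [wL, if_neg, mul_zero]
      rintro ⟨k, hk⟩
      exact hg ⟨some k, hk.symm⟩
  have hc : ((1 / Real.sqrt L : ℝ) : ℂ) ≠ 0 := by
    have : (0 : ℝ) < L := by exact_mod_cast (by omega : 0 < L)
    have := Real.sqrt_pos.2 this
    exact_mod_cast (one_div_pos.2 this).ne'
  refine ⟨U, l • tensorL R (wL L), hU, ?_, ?_, ?_⟩
  · intro f hf
    rw [Pi.smul_apply, hform, Finset.sum_eq_zero, smul_zero]
    intro m _
    obtain ⟨j, hj, hj1⟩ := two_ones hf m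
    rw [Finset.prod_eq_zero (Finset.mem_univ j), zero_mul]
    simp [basisE, hj, hj1, h10]
  · intro k
    rw [Pi.smul_apply, hform, Finset.sum_eq_single k]
    · refine smul_ne_zero hl (mul_ne_zero (Finset.prod_ne_zero_iff.2 ?_) hc)
      intro j _
      by_cases hj : j = k
      · subst hj; simp [basisE, h11]
      · simp [basisE, hj, h00]
    · intro m _ hm
      rw [Finset.prod_eq_zero (Finset.mem_univ k), zero_mul]
      simp [basisE, hm.symm, h10]
    · simp
  · have : tensorL U (l • tensorL R (wL L)) = l • tensorL U (tensorL R (wL L)) := by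
      simp only [tensorL_eq, Matrix.mulVec_smul]
    rw [this, tensorL_tensorL]
    congr 2
    funext k
    exact hAe k

theorem exists_phase_s1 (x y : ℂ) (h : Complex.normSq x = Complex.normSq y) :
    ∃ μ : ℂ, μ * star μ = 1 ∧ y = μ * x := by
  by_cases hx : x = 0
  · subst hx
    refine ⟨1, by simp, ?_⟩
    rw [map_zero] at h
    rw [mul_zero]; exact Complex.normSq_eq_zero.1 h.symm
  · refine ⟨y / x, ?_, by field_simp⟩
    rw [Complex.star_def, Complex.mul_conj, map_div₀, ← h, div_self, Complex.ofReal_one]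
    exact fun h' => hx (Complex.normSq_eq_zero.1 h')

theorem tensorL_diag {L : ℕ} (D : Fin L → Fin 2 → ℂ) (v : HL L) (f : Fin L → Fin 2) :
    tensorL (fun k => Matrix.diagonal (D k)) v f = (∏ k, D k (f k)) * v f := by
  rw [tensorL, Finset.sum_eq_single f]
  · simp
  · intro g _ hg
    obtain ⟨i, hi⟩ := Function.ne_iff.1 hg
    rw [Finset.prod_eq_zero (Finset.mem_univ i), zero_mul]
    exact Matrix.diagonal_apply_ne _ hi.symm
  · simp

theorem phase_match {L : ℕ} (hL : 3 ≤ L) (s t : HL L) (hs : SuppW s) (ht : SuppW t)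
    (h : ∀ o, Complex.normSq (s (basisE o)) = Complex.normSq (t (basisE o))) :
    ∃ U : Fin L → Matrix (Fin 2) (Fin 2) ℂ,
      (∀ k, U k ∈ Matrix.unitaryGroup (Fin 2) ℂ) ∧ t = tensorL U s := by
  choose μ hμ hμ' using fun o => exists_phase_s1 _ _ (h o)
  let k0 : Fin L := ⟨0, by omega⟩
  let α : Fin L → ℂ := fun k => if k = k0 then μ none else 1
  have hα : ∀ k, α k * star (α k) = 1 := by
    intro k
    by_cases hk : k = k0
    · simp only [α, if_pos hk]; exact hμ none
    · simp [α, if_neg hk]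
  have hprod : ∏ k, α k = μ none := by simp [α]
  let D : Fin L → Fin 2 → ℂ := fun k => ![α k, α k * μ (some k) * star (μ none)]
  refine ⟨fun k => Matrix.diagonal (D k), ?_, ?_⟩
  · intro k
    rw [Matrix.mem_unitaryGroup_iff, Matrix.star_eq_conjTranspose, Matrix.diagonal_conjTranspose,
      Matrix.diagonal_mul_diagonal, ← Matrix.diagonal_one]
    congr 1
    funext i
    fin_cases i
    · exact hα k
    · change α k * μ (some k) * star (μ none) * star (α k * μ (some k) * star (μ none)) = 1
      rw [star_mul', star_mul', star_star]
      calc _ = (α k * star (α k)) * (μ (some k) * star (μ (some k))) * (μ none * star (μ none)) := by ring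
        _ = 1 := by rw [hα, hμ, hμ]; ring
  · funext f
    rw [tensorL_diag]
    by_cases hf : f ∈ Set.range (basisE (L := L))
    · obtain ⟨(_ | k), rfl⟩ := hf
      · have : ∏ k, D k (basisE none k) = μ none := by
          rw [← hprod]; rfl
        rw [this]; exact hμ' none
      · have : ∏ j, D j (basisE (some k) j) = μ (some k) := by
          have e : ∀ j, D j (basisE (some k) j) = α j * (if j = k then μ (some k) * star (μ none) else 1) := by
            intro j
            by_cases hj : j = k
            · subst hj; simp [basisE, D, mul_assoc]
            · simp [basisE, D, hj]
          rw [Finset.prod_congr rfl (fun j _ => e j), Finset.prod_mul_distrib, hprod]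
          rw [Finset.prod_ite_eq' Finset.univ k (fun _ => μ (some k) * star (μ none)), if_pos (Finset.mem_univ k)]
          linear_combination μ (some k) * hμ none
        rw [this]; exact hμ' (some k)
    · rw [hs f hf, ht f hf, mul_zero]

theorem W_class_states_with_equal_local_spectra_are_LU_equivalent
    (L : ℕ) (hL : 3 ≤ L) (v w : HL L)
    (hv : v ∈ WClassL L) (hw : w ∈ WClassL L)
    (hvu : normSqL v = 1) (hwu : normSqL w = 1)
    (hspec : ∀ k : Fin L, minEig (rhoL k v) = minEig (rhoL k w)) :
    ∃ U : Fin L → Matrix (Fin 2) (Fin 2) ℂ,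
      (∀ k, U k ∈ Matrix.unitaryGroup (Fin 2) ℂ) ∧ w = tensorL U v := by
  have hdet : ∀ k, (rhoL k v).det = (rhoL k w).det := by
    intro k
    rw [det_rhoL_minEig k v hvu, det_rhoL_minEig k w hwu, hspec]
  obtain ⟨A, s, hA, hs, hs0, rfl⟩ := normal_form hL v hv
  obtain ⟨B, t, hB, ht, ht0, rfl⟩ := normal_form hL w hw
  let k0 : Fin L := ⟨0, by omega⟩
  have hsn : normSqL s = 1 := by
    have := trace_rhoL_tensorL k0 A hA s
    rw [trace_rhoL, trace_rhoL, hvu] at this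
    exact_mod_cast this.symm
  have htn : normSqL t = 1 := by
    have := trace_rhoL_tensorL k0 B hB t
    rw [trace_rhoL, trace_rhoL, hwu] at this
    exact_mod_cast this.symm
  have hpq := uniq (by simpa using hL) (fun k => Complex.normSq (s (basisE (some k))))
    (fun k => Complex.normSq (t (basisE (some k)))) (fun k => Complex.normSq_pos.2 (hs0 k))
    (fun k => Complex.normSq_pos.2 (ht0 k)) (by
      intro k
      have := hdet k
      rw [det_rhoL_tensorL k A hA, det_rhoL_tensorL k B hB, det_rhoL_supp s hs, det_rhoL_supp t ht] at this
      exact_mod_cast this)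
  have hall : ∀ o, Complex.normSq (s (basisE o)) = Complex.normSq (t (basisE o)) := by
    rintro (_ | k)
    · rw [normSq_supp s hs] at hsn
      rw [normSq_supp t ht] at htn
      have h1 : ∑ k, Complex.normSq (s (basisE (some k))) = ∑ k, Complex.normSq (t (basisE (some k))) :=
        Finset.sum_congr rfl (fun k _ => congrFun hpq k)
      linarith
    · exact congrFun hpq k
  obtain ⟨D, hD, rfl⟩ := phase_match hL s t hs ht hall
  refine ⟨fun k => B k * (D k * star (A k)), ?_, ?_⟩
  · intro k
    exact mul_mem (hB k) (mul_mem (hD k) (Unitary.star_mem (hA k)))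
  · rw [tensorL_tensorL, tensorL_tensorL]
    congr 1
    funext k
    rw [Matrix.mul_assoc, Matrix.mul_assoc, Matrix.mem_unitaryGroup_iff'.1 (hA k), Matrix.mul_one]
end

section
/- Let v be a unit vector in H₃ with p_i(v) < 1/2 for all i ∈ {1,2,3} and p_i(v) < p_j(v) + p_k(v) for every permutation (i,j,k) of (1,2,3). Then there exists an uncountable set S of unit vectors in H₃ such that every w ∈ S satisfies p_i(w) = p_i(v) for i = 1,2,3, and any two distinct elements of S are not LU-equivalent. (This reflects that the set of LU-classes with these fixed local spectra forms a two-dimensional space.) -/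
open scoped BigOperators

lemma aux_q0 (A B C D w : ℝ) (hs : A = 1 - B - C - D) (hw : w ^ 2 = A * B * C * D) :
    2 * ((2 * (A * B + C * D) + 4 * w) * (2 * (A * C + B * D) + 4 * w)
      * (2 * (A * D + B * C) + 4 * w))
      = (4 * (A * B * C + A * B * D + A * C * D + B * C * D + w)) ^ 2 := by
  subst hs
  linear_combination (-16 * (1 - 4 * ((1 - B - C - D) * (B + C + D) + B * C + B * D + C * D)
    - 8 * w)) * hw

lemma aux_q1 (A B C D w : ℝ) (hs : A = 1 - B - C - D) (hw : w ^ 2 = A * B * C * D) :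
    2 * ((2 * (A * B + C * D) + 4 * w) * (2 * (A * C + B * D) + 4 * w)
      + (2 * (A * B + C * D) + 4 * w) * (2 * (A * D + B * C) + 4 * w)
      + (2 * (A * C + B * D) + 4 * w) * (2 * (A * D + B * C) + 4 * w))
      = 2 * (4 * (A * B * C + A * B * D + A * C * D + B * C * D + w)) * (1 + 8 * w)
        - 8 * w * ((A + B - C - D) * (A + C - B - D) * (A + D - B - C)) := by
  subst hs
  linear_combination 32 * hw

lemma aux_E (A B C D w : ℝ) (hs : A = 1 - B - C - D) (hw : w ^ 2 = A * B * C * D) :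
    4 * ((A * B + C * D) * (A * C + B * D) + (A * B + C * D) * (A * D + B * C)
      + (A * C + B * D) * (A * D + B * C)) + 4 * w + 16 * w ^ 2
      = 4 * (A * B * C + A * B * D + A * C * D + B * C * D + w) := by
  rw [hw]; subst hs; ring

lemma aux_taylor (y1 y2 y3 w s E R k l F : ℝ) (hE : E = 4 * (y1 * y2 + y1 * y3 + y2 * y3))
    (hF : E + 4 * w + 16 * w ^ 2 = F)
    (hk : k = 2 * (2 * y1 + 2 * y2 + 2 * y3 + 12 * w)
      - ((1 + 8 * w) ^ 2 + 2 * F))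
    (hl : l = -2 + 2 * (1 + 8 * w))
    (q0 : 2 * ((2 * y1 + 4 * w) * (2 * y2 + 4 * w) * (2 * y3 + 4 * w)) = F ^ 2)
    (q1 : 2 * ((2 * y1 + 4 * w) * (2 * y2 + 4 * w) + (2 * y1 + 4 * w) * (2 * y3 + 4 * w)
      + (2 * y2 + 4 * w) * (2 * y3 + 4 * w)) = 2 * F * (1 + 8 * w) - 8 * w * R) :
    2 * ((2 * y1 + (4 * w - s)) * (2 * y2 + (4 * w - s)) * (2 * y3 + (4 * w - s)))
        - (2 * y1 * (2 * y2) + 2 * y1 * (2 * y3) + 2 * y2 * (2 * y3) + (4 * w - s)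
          + (4 * w - s) ^ 2) ^ 2 = s * (8 * w * R + s * (k + s * l - s ^ 2)) := by
  have e : 2 * y1 * (2 * y2) + 2 * y1 * (2 * y3) + 2 * y2 * (2 * y3) + (4 * w - s)
          + (4 * w - s) ^ 2 = F - s * (1 + 8 * w) + s ^ 2 := by
    rw [← hF, hE]; ring
  rw [e, hk, hl]
  linear_combination q0 - s * q1

open Filter Topology in
/-- Real algebra: existence of an admissible value of the three-tangle parameter. -/
lemma aux_exists_t (p q r : ℝ) (h1 : p < 1 / 2) (h2 : q < 1 / 2) (h3 : r < 1 / 2)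
    (k1 : p < q + r) (k2 : q < p + r) (k3 : r < p + q) :
    ∃ t e1 e2 e3 : ℝ, 0 < t ∧ t < e1 ∧ t < e2 ∧ t < e3 ∧
      e2 + e3 = 2 * (p * (1 - p)) ∧ e1 + e3 = 2 * (q * (1 - q)) ∧
      e1 + e2 = 2 * (r * (1 - r)) ∧
      (e1 * e2 + e1 * e3 + e2 * e3 + t + t ^ 2) ^ 2
        < 2 * ((e1 + t) * (e2 + t) * (e3 + t)) := by
  obtain ⟨A, hA⟩ : ∃ A, A = (2 - p - q - r) / 2 := ⟨_, rfl⟩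
  obtain ⟨B, hB⟩ : ∃ B, B = (q + r - p) / 2 := ⟨_, rfl⟩
  obtain ⟨C, hC⟩ : ∃ C, C = (p + r - q) / 2 := ⟨_, rfl⟩
  obtain ⟨D, hD⟩ : ∃ D, D = (p + q - r) / 2 := ⟨_, rfl⟩
  have A0 : 0 < A := by linarith
  have B0 : 0 < B := by linarith
  have C0 : 0 < C := by linarith
  have D0 : 0 < D := by linarith
  have hP : 0 < A * B * C * D := by positivity
  obtain ⟨w, hw0, hw⟩ : ∃ w, 0 < w ∧ w ^ 2 = A * B * C * D :=
    ⟨√(A * B * C * D), Real.sqrt_pos.2 hP, Real.sq_sqrt hP.le⟩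
  have amgm : ∀ X Y : ℝ, 0 < X → 0 < Y → X * Y = w ^ 2 → 2 * w ≤ X + Y := by
    intro X Y hX hY hXY
    nlinarith [sq_nonneg (X - Y)]
  have g1 := amgm (A * B) (C * D) (by positivity) (by positivity) (by rw [hw]; ring)
  have g2 := amgm (A * C) (B * D) (by positivity) (by positivity) (by rw [hw]; ring)
  have g3 := amgm (A * D) (B * C) (by positivity) (by positivity) (by rw [hw]; ring)
  have hsum : A = 1 - B - C - D := by linarith
  have hR : 0 < (A + B - C - D) * (A + C - B - D) * (A + D - B - C) := by
    have a1 : 0 < A + B - C - D := by linarith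
    have a2 : 0 < A + C - B - D := by linarith
    have a3 : 0 < A + D - B - C := by linarith
    positivity
  obtain ⟨R, hRdef⟩ : ∃ R, R = (A + B - C - D) * (A + C - B - D) * (A + D - B - C) := ⟨_, rfl⟩
  obtain ⟨y1, hy1⟩ : ∃ y, y = A * B + C * D := ⟨_, rfl⟩
  obtain ⟨y2, hy2⟩ : ∃ y, y = A * C + B * D := ⟨_, rfl⟩
  obtain ⟨y3, hy3⟩ : ∃ y, y = A * D + B * C := ⟨_, rfl⟩
  obtain ⟨F, hF⟩ : ∃ F, F = 4 * (A * B * C + A * B * D + A * C * D + B * C * D + w) := ⟨_, rfl⟩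
  have q0 := aux_q0 A B C D w hsum hw
  have q1 := aux_q1 A B C D w hsum hw
  have qE := aux_E A B C D w hsum hw
  rw [← hy1, ← hy2, ← hy3, ← hF] at q0 q1 qE
  rw [← hRdef] at q1 hR
  rw [← hy1] at g1
  rw [← hy2] at g2
  rw [← hy3] at g3
  -- second order Taylor coefficients
  obtain ⟨k, hk⟩ : ∃ k, k = 2 * (2 * y1 + 2 * y2 + 2 * y3 + 12 * w)
    - ((1 + 8 * w) ^ 2 + 2 * F) := ⟨_, rfl⟩
  obtain ⟨l, hl⟩ : ∃ l, l = -2 + 2 * (1 + 8 * w) := ⟨_, rfl⟩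
  have hc : Tendsto (fun s : ℝ => 8 * w * R + s * (k + s * l - s ^ 2)) (𝓝 0)
      (𝓝 (8 * w * R + 0 * (k + 0 * l - 0 ^ 2))) := by
    apply Continuous.tendsto (f := fun s : ℝ => 8 * w * R + s * (k + s * l - s ^ 2))
    fun_prop
  have hpos : 0 < 8 * w * R + 0 * (k + 0 * l - 0 ^ 2) := by
    have : 0 < 8 * w * R := by positivity
    linarith
  have ev1 := hc.eventually (lt_mem_nhds hpos)
  have ev2 : ∀ᶠ s : ℝ in 𝓝 0, s < w := gt_mem_nhds hw0
  have ev := ((ev1.and ev2).filter_mono nhdsWithin_le_nhds).and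
    (self_mem_nhdsWithin : Set.Ioi (0 : ℝ) ∈ 𝓝[>] 0)
  obtain ⟨s, ⟨hs1, hs2⟩, hs0⟩ := ev.exists
  have hs0 : 0 < s := hs0
  refine ⟨4 * w - s, 2 * y1, 2 * y2, 2 * y3, by linarith, by linarith, by linarith, by linarith,
    ?_, ?_, ?_, ?_⟩
  · rw [hy2, hy3, hA, hB, hC, hD]; ring
  · rw [hy1, hy3, hA, hB, hC, hD]; ring
  · rw [hy1, hy2, hA, hB, hC, hD]; ring
  · have key := aux_taylor y1 y2 y3 w s _ R k l F rfl qE hk hl q0 q1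
    have := mul_pos hs0 hs1
    linarith

/-- Second real step: parameters of the GHZ-type normal form. -/
lemma aux_params (d1 d2 d3 t e1 e2 e3 : ℝ) (t0 : 0 < t) (h1 : t < e1) (h2 : t < e2) (h3 : t < e3)
    (f1 : e2 + e3 = 2 * d1) (f2 : e1 + e3 = 2 * d2) (f3 : e1 + e2 = 2 * d3)
    (hQ : (e1 * e2 + e1 * e3 + e2 * e3 + t + t ^ 2) ^ 2
        < 2 * ((e1 + t) * (e2 + t) * (e3 + t))) :
    ∃ q c1 c2 c3 s1 s2 s3 : ℝ, 0 < q ∧ 0 < c1 ∧ 0 < c2 ∧ 0 < c3 ∧ 0 < s1 ∧ 0 < s2 ∧ 0 < s3 ∧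
      c1 ^ 2 + s1 ^ 2 = 1 ∧ c2 ^ 2 + s2 ^ 2 = 1 ∧ c3 ^ 2 + s3 ^ 2 = 1 ∧
      q ^ 2 * s1 ^ 2 * (1 - c2 ^ 2 * c3 ^ 2) = d1 ∧
      q ^ 2 * s2 ^ 2 * (1 - c1 ^ 2 * c3 ^ 2) = d2 ∧
      q ^ 2 * s3 ^ 2 * (1 - c1 ^ 2 * c2 ^ 2) = d3 ∧
      2 * q * (1 - c1 * c2 * c3) < 1 := by
  obtain ⟨u1, hu1⟩ : ∃ u, u = (e1 - t) / 2 := ⟨_, rfl⟩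
  obtain ⟨u2, hu2⟩ : ∃ u, u = (e2 - t) / 2 := ⟨_, rfl⟩
  obtain ⟨u3, hu3⟩ : ∃ u, u = (e3 - t) / 2 := ⟨_, rfl⟩
  have p1 : 0 < u1 := by linarith
  have p2 : 0 < u2 := by linarith
  have p3 : 0 < u3 := by linarith
  obtain rfl : e1 = 2 * u1 + t := by linarith
  obtain rfl : e2 = 2 * u2 + t := by linarith
  obtain rfl : e3 = 2 * u3 + t := by linarith
  obtain rfl : d1 = u2 + u3 + t := by linarith
  obtain rfl : d2 = u1 + u3 + t := by linarith
  obtain rfl : d3 = u1 + u2 + t := by linarith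
  obtain ⟨a1, a10, ha1⟩ : ∃ a, 0 < a ∧ a ^ 2 = u1 := ⟨√u1, Real.sqrt_pos.2 p1, Real.sq_sqrt p1.le⟩
  obtain ⟨a2, a20, ha2⟩ : ∃ a, 0 < a ∧ a ^ 2 = u2 := ⟨√u2, Real.sqrt_pos.2 p2, Real.sq_sqrt p2.le⟩
  obtain ⟨a3, a30, ha3⟩ : ∃ a, 0 < a ∧ a ^ 2 = u3 := ⟨√u3, Real.sqrt_pos.2 p3, Real.sq_sqrt p3.le⟩
  obtain ⟨b, b0, hb⟩ : ∃ a, 0 < a ∧ a ^ 2 = t := ⟨√t, Real.sqrt_pos.2 t0, Real.sq_sqrt t0.le⟩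
  obtain ⟨g1, g10, hg1⟩ : ∃ a, 0 < a ∧ a ^ 2 = t + u1 :=
    ⟨√(t + u1), Real.sqrt_pos.2 (by linarith), Real.sq_sqrt (by linarith)⟩
  obtain ⟨g2, g20, hg2⟩ : ∃ a, 0 < a ∧ a ^ 2 = t + u2 :=
    ⟨√(t + u2), Real.sqrt_pos.2 (by linarith), Real.sq_sqrt (by linarith)⟩
  obtain ⟨g3, g30, hg3⟩ : ∃ a, 0 < a ∧ a ^ 2 = t + u3 :=
    ⟨√(t + u3), Real.sqrt_pos.2 (by linarith), Real.sq_sqrt (by linarith)⟩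
  refine ⟨g1 * g2 * g3 / t, a1 / g1, a2 / g2, a3 / g3, b / g1, b / g2, b / g3,
    by positivity, by positivity, by positivity, by positivity, by positivity, by positivity,
    by positivity, ?_, ?_, ?_, ?_, ?_, ?_, ?_⟩
  · field_simp; linarith
  · field_simp; linarith
  · field_simp; linarith
  · field_simp
    rw [hb, hg2, hg3, ha2, ha3]; ring
  · field_simp
    rw [hb, hg1, hg3, ha1, ha3]; ring
  · field_simp
    rw [hb, hg1, hg2, ha1, ha2]; ring
  · have e : 2 * (g1 * g2 * g3 / t) * (1 - a1 / g1 * (a2 / g2) * (a3 / g3))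
        = (2 * (g1 * g2 * g3) - 2 * (a1 * a2 * a3)) / t := by
      field_simp
    rw [e, div_lt_one t0]
    obtain ⟨G, hG⟩ : ∃ G, G = g1 * g2 * g3 := ⟨_, rfl⟩
    obtain ⟨h, hh⟩ : ∃ h, h = a1 * a2 * a3 := ⟨_, rfl⟩
    have G0 : 0 < G := by rw [hG]; positivity
    have h0 : 0 < h := by rw [hh]; positivity
    have hG2 : G ^ 2 = (t + u1) * (t + u2) * (t + u3) := by
      rw [hG, mul_pow, mul_pow, hg1, hg2, hg3]
    have hh2 : h ^ 2 = u1 * u2 * u3 := by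
      rw [hh, mul_pow, mul_pow, ha1, ha2, ha3]
    rw [← hG, ← hh]
    set X := (2 * u1 + t) * (2 * u2 + t) + (2 * u1 + t) * (2 * u3 + t)
      + (2 * u2 + t) * (2 * u3 + t) + t + t ^ 2 with hX
    have hlt : X < 4 * G := by
      apply lt_of_pow_lt_pow_left₀ 2 (by positivity)
      calc X ^ 2 < _ := hQ
        _ = (4 * G) ^ 2 := by rw [mul_pow, hG2]; ring
    have h4 : (2 * G - t) ^ 2 < (2 * h) ^ 2 := by
      have : (2 * h) ^ 2 - (2 * G - t) ^ 2 = t * (4 * G - X) := by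
        rw [hX]; linear_combination 4 * hh2 - 4 * hG2
      nlinarith [mul_pos t0 (sub_pos.2 hlt)]
    have := lt_of_pow_lt_pow_left₀ 2 (by positivity) h4
    linarith

/-! Spectrum of the 2×2 matrices. -/

lemma aux_mem_spec (M : Matrix (Fin 2) (Fin 2) ℂ) (z : ℂ) :
    z ∈ spectrum ℂ M ↔ z ^ 2 - (M 0 0 + M 1 1) * z + M.det = 0 := by
  rw [spectrum.mem_iff, Matrix.isUnit_iff_isUnit_det, isUnit_iff_ne_zero, not_not,
    Matrix.det_fin_two, Matrix.det_fin_two]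
  simp [Matrix.algebraMap_matrix_apply]
  constructor <;> intro h <;> linear_combination h

lemma aux_minEig_congr (M N : Matrix (Fin 2) (Fin 2) ℂ) (ht : M 0 0 + M 1 1 = N 0 0 + N 1 1)
    (hd : M.det = N.det) : minEig M = minEig N := by
  unfold minEig
  congr 1
  ext t
  simp only [Set.mem_ofPred_eq, aux_mem_spec, ht, hd]

/-- For a Hermitian trace one matrix, the determinant is `p (1 - p)`. -/
lemma aux_det_eq (M : Matrix (Fin 2) (Fin 2) ℂ) (ht : M 0 0 + M 1 1 = 1) (x : ℝ)
    (hx : M 0 0 = x) (hoff : M 1 0 = star (M 0 1)) :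
    M.det = ((minEig M * (1 - minEig M) : ℝ) : ℂ) := by
  obtain ⟨n, hn, hM⟩ : ∃ n : ℝ, 0 ≤ n ∧ M 0 1 * M 1 0 = n := by
    refine ⟨Complex.normSq (M 0 1), Complex.normSq_nonneg _, ?_⟩
    rw [hoff]; exact Complex.mul_conj _
  have h11 : M 1 1 = 1 - x := by rw [← hx]; linear_combination ht
  have hdet : M.det = ((x * (1 - x) - n : ℝ) : ℂ) := by
    rw [Matrix.det_fin_two, hM, hx, h11]; push_cast; ring
  set d := x * (1 - x) - n with hd
  have hdisc : 0 ≤ 1 - 4 * d := by nlinarith [sq_nonneg (1 - 2 * x)]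
  obtain ⟨r, hr0, hr⟩ : ∃ r, 0 ≤ r ∧ r ^ 2 = 1 - 4 * d :=
    ⟨√(1 - 4 * d), Real.sqrt_nonneg _, Real.sq_sqrt hdisc⟩
  have hmin : minEig M = (1 - r) / 2 := by
    unfold minEig
    apply IsLeast.csInf_eq
    have hiff : ∀ s : ℝ, (s : ℂ) ∈ spectrum ℂ M ↔ s ^ 2 - s + d = 0 := by
      intro s
      rw [aux_mem_spec, ht, hdet]
      constructor
      · intro h
        have h' : ((s ^ 2 - s + d : ℝ) : ℂ) = 0 := by push_cast; linear_combination h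
        exact_mod_cast h'
      · intro h
        have h' : ((s ^ 2 - s + d : ℝ) : ℂ) = 0 := by rw [h]; simp
        push_cast at h'; linear_combination h'
    constructor
    · rw [Set.mem_ofPred_eq, hiff]; linear_combination hr / 4
    · intro s hs
      rw [Set.mem_ofPred_eq, hiff] at hs
      by_contra! hlt
      nlinarith
  rw [hdet, hmin]
  congr 1
  linear_combination hr / 4

/-- The one-qubit quadratic covariant. -/
noncomputable def covB (v : H3) : Matrix (Fin 2) (Fin 2) ℂ :=
  Matrix.of fun a a' => v (a, 0, 0) * v (a', 1, 1) + v (a', 0, 0) * v (a, 1, 1)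
    - v (a, 0, 1) * v (a', 1, 0) - v (a', 0, 1) * v (a, 1, 0)

noncomputable def invK (v : H3) : ℂ := (covB v * (covB v).conjTranspose * rho1 v).trace

lemma covB_tensor (U1 U2 U3 : Matrix (Fin 2) (Fin 2) ℂ) (v : H3) :
    covB (tensor3 U1 U2 U3 v) = (U2.det * U3.det) • (U1 * covB v * U1.transpose) := by
  ext i j
  simp only [covB, tensor3, Matrix.det_fin_two, Matrix.smul_apply, Matrix.mul_apply,
    Fin.sum_univ_two, Matrix.of_apply, Matrix.transpose_apply, smul_eq_mul]
  ring

/-- The flattening of the tensor. -/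
noncomputable def flat (v : H3) : Matrix (Fin 2) (Fin 2 × Fin 2) ℂ :=
  Matrix.of fun a x => v (a, x.1, x.2)

lemma rho1_flat (v : H3) : rho1 v = flat v * (flat v).conjTranspose := by
  ext i j
  simp [rho1, flat, Matrix.mul_apply, Fintype.sum_prod_type]

lemma flat_tensor (U1 U2 U3 : Matrix (Fin 2) (Fin 2) ℂ) (v : H3) :
    flat (tensor3 U1 U2 U3 v) = U1 * flat v * (Matrix.kroneckerMap (· * ·) U2 U3).transpose := by
  ext i ⟨j, k⟩
  simp [flat, tensor3, Matrix.mul_apply, Fintype.sum_prod_type, Matrix.kroneckerMap_apply]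
  ring

lemma rho1_tensor (U1 U2 U3 : Matrix (Fin 2) (Fin 2) ℂ) (v : H3)
    (h2 : U2 ∈ Matrix.unitaryGroup (Fin 2) ℂ) (h3 : U3 ∈ Matrix.unitaryGroup (Fin 2) ℂ) :
    rho1 (tensor3 U1 U2 U3 v) = U1 * rho1 v * U1.conjTranspose := by
  have hK : (Matrix.kroneckerMap (· * ·) U2 U3) ∈ Matrix.unitaryGroup (Fin 2 × Fin 2) ℂ :=
    Matrix.kronecker_mem_unitary h2 h3
  set W := Matrix.kroneckerMap (· * ·) U2 U3 with hW
  have hWW : W.transpose * W.transpose.conjTranspose = 1 := by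
    have h := Matrix.mem_unitaryGroup_iff'.1 hK
    rw [Matrix.star_eq_conjTranspose] at h
    have h' := congrArg Matrix.transpose h
    rw [Matrix.transpose_mul, Matrix.transpose_one] at h'
    exact h'
  rw [rho1_flat, flat_tensor, rho1_flat, ← hW, Matrix.conjTranspose_mul, Matrix.conjTranspose_mul]
  calc U1 * flat v * W.transpose * (W.transpose.conjTranspose * ((flat v).conjTranspose * U1.conjTranspose))
      = U1 * flat v * (W.transpose * W.transpose.conjTranspose) * ((flat v).conjTranspose * U1.conjTranspose) := by
        simp only [Matrix.mul_assoc]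
    _ = _ := by rw [hWW]; simp only [Matrix.mul_assoc, Matrix.mul_one]

lemma invK_LU (v w : H3) (h : LUequiv v w) : invK w = invK v := by
  obtain ⟨U1, U2, U3, h1, h2, h3, rfl⟩ := h
  have n2 : U2.det * star U2.det = 1 := (Unitary.mem_iff.1 (Matrix.det_of_mem_unitary h2)).2
  have n3 : U3.det * star U3.det = 1 := (Unitary.mem_iff.1 (Matrix.det_of_mem_unitary h3)).2
  have u1 : U1.conjTranspose * U1 = 1 := Matrix.mem_unitaryGroup_iff'.1 h1
  have u1t : U1.transpose * U1.transpose.conjTranspose = 1 := by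
    have h' := congrArg Matrix.transpose u1
    rw [Matrix.transpose_mul, Matrix.transpose_one] at h'
    exact h'
  unfold invK
  rw [covB_tensor, rho1_tensor U1 U2 U3 v h2 h3]
  set B := covB v
  set P := rho1 v
  have e1 : (U2.det * U3.det) • (U1 * B * U1.transpose)
      * ((U2.det * U3.det) • (U1 * B * U1.transpose)).conjTranspose
      = U1 * (B * B.conjTranspose) * U1.conjTranspose := by
    rw [Matrix.conjTranspose_smul, Matrix.smul_mul, Matrix.mul_smul, smul_smul]
    have : U2.det * U3.det * star (U2.det * U3.det) = 1 := by
      rw [star_mul']; linear_combination n2 * (U3.det * star U3.det) + n3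
    rw [this, one_smul, Matrix.conjTranspose_mul, Matrix.conjTranspose_mul]
    calc U1 * B * U1.transpose * (U1.transpose.conjTranspose * (B.conjTranspose * U1.conjTranspose))
        = U1 * B * (U1.transpose * U1.transpose.conjTranspose) * (B.conjTranspose * U1.conjTranspose) := by
          simp only [Matrix.mul_assoc]
      _ = _ := by rw [u1t]; simp only [Matrix.mul_assoc, Matrix.mul_one]
  rw [e1]
  have e2 : U1 * (B * B.conjTranspose) * U1.conjTranspose * (U1 * P * U1.conjTranspose)
      = U1 * (B * B.conjTranspose * P) * U1.conjTranspose := by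
    calc _ = U1 * (B * B.conjTranspose) * (U1.conjTranspose * U1) * (P * U1.conjTranspose) := by
          simp only [Matrix.mul_assoc]
      _ = _ := by rw [u1]; simp only [Matrix.mul_assoc, Matrix.mul_one]
  rw [e2, Matrix.trace_mul_comm, ← Matrix.mul_assoc, u1, Matrix.one_mul]

/-- The GHZ-type normal form. -/
noncomputable def ghzForm (x y c1 c2 c3 s1 s2 s3 : ℝ) (ζ : ℂ) : H3 := fun i =>
  (if i = (0, 0, 0) then (x : ℂ) else 0)
    + y * ζ * (![(c1 : ℂ), s1] i.1 * ![(c2 : ℂ), s2] i.2.1 * ![(c3 : ℂ), s3] i.2.2)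

section
variable (x y c1 c2 c3 s1 s2 s3 : ℝ) (ζ : ℂ)

lemma normSq3_cast (v : H3) : ((normSq3 v : ℝ) : ℂ) = ∑ a, ∑ b, ∑ c, v (a, b, c) * star (v (a, b, c)) := by
  simp [normSq3, Fintype.sum_prod_type, ← Complex.mul_conj]

lemma ghz_norm (h : ζ * star ζ = 1) (h1 : c1 ^ 2 + s1 ^ 2 = 1) (h2 : c2 ^ 2 + s2 ^ 2 = 1)
    (h3 : c3 ^ 2 + s3 ^ 2 = 1) :
    normSq3 (ghzForm x y c1 c2 c3 s1 s2 s3 ζ)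
      = x ^ 2 + y ^ 2 + 2 * (x * y) * (c1 * c2 * c3) * ζ.re := by
  have hre : ζ + star ζ = ((2 * ζ.re : ℝ) : ℂ) := Complex.add_conj ζ
  have g1 : (c1 : ℂ) ^ 2 + (s1 : ℂ) ^ 2 = 1 := by exact_mod_cast h1
  have g2 : (c2 : ℂ) ^ 2 + (s2 : ℂ) ^ 2 = 1 := by exact_mod_cast h2
  have g3 : (c3 : ℂ) ^ 2 + (s3 : ℂ) ^ 2 = 1 := by exact_mod_cast h3
  have : ((normSq3 (ghzForm x y c1 c2 c3 s1 s2 s3 ζ) : ℝ) : ℂ)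
      = ((x ^ 2 + y ^ 2 + 2 * (x * y) * (c1 * c2 * c3) * ζ.re : ℝ) : ℂ) := by
    rw [normSq3_cast]
    push_cast at hre
    push_cast
    simp [ghzForm, Fin.sum_univ_two]
    simp only [← starRingEnd_apply] at h hre
    generalize (starRingEnd ℂ) ζ = η at *
    have e : (y : ℂ) ^ 2 = y ^ 2 * (ζ * η) * (((c1 : ℂ) ^ 2 + (s1 : ℂ) ^ 2)
      * ((c2 : ℂ) ^ 2 + (s2 : ℂ) ^ 2) * ((c3 : ℂ) ^ 2 + (s3 : ℂ) ^ 2)) := by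
      rw [h, g1, g2, g3]; ring
    rw [e]
    linear_combination (x * y * c1 * c2 * c3 : ℂ) * hre
  exact_mod_cast this

lemma ghz_det1 (h : ζ * star ζ = 1) (h2 : c2 ^ 2 + s2 ^ 2 = 1) (h3 : c3 ^ 2 + s3 ^ 2 = 1) :
    (rho1 (ghzForm x y c1 c2 c3 s1 s2 s3 ζ)).det
      = (((x * y) ^ 2 * s1 ^ 2 * (1 - c2 ^ 2 * c3 ^ 2) : ℝ) : ℂ) := by
  have e : (((x * y) ^ 2 * s1 ^ 2 * (1 - c2 ^ 2 * c3 ^ 2) : ℝ) : ℂ)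
      = (((x * y) ^ 2 * s1 ^ 2 * ((c2 ^ 2 + s2 ^ 2) * (c3 ^ 2 + s3 ^ 2) - c2 ^ 2 * c3 ^ 2) : ℝ) : ℂ)
        * (ζ * star ζ) := by
    rw [h, h2, h3]; simp
  rw [e]
  simp [ghzForm, rho1, Matrix.det_fin_two, Fin.sum_univ_two]
  ring

lemma ghz_det2 (h : ζ * star ζ = 1) (h1 : c1 ^ 2 + s1 ^ 2 = 1) (h3 : c3 ^ 2 + s3 ^ 2 = 1) :
    (rho2 (ghzForm x y c1 c2 c3 s1 s2 s3 ζ)).det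
      = (((x * y) ^ 2 * s2 ^ 2 * (1 - c1 ^ 2 * c3 ^ 2) : ℝ) : ℂ) := by
  have e : (((x * y) ^ 2 * s2 ^ 2 * (1 - c1 ^ 2 * c3 ^ 2) : ℝ) : ℂ)
      = (((x * y) ^ 2 * s2 ^ 2 * ((c1 ^ 2 + s1 ^ 2) * (c3 ^ 2 + s3 ^ 2) - c1 ^ 2 * c3 ^ 2) : ℝ) : ℂ)
        * (ζ * star ζ) := by
    rw [h, h1, h3]; simp
  rw [e]
  simp [ghzForm, rho2, Matrix.det_fin_two, Fin.sum_univ_two]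
  ring

lemma ghz_det3 (h : ζ * star ζ = 1) (h1 : c1 ^ 2 + s1 ^ 2 = 1) (h2 : c2 ^ 2 + s2 ^ 2 = 1) :
    (rho3 (ghzForm x y c1 c2 c3 s1 s2 s3 ζ)).det
      = (((x * y) ^ 2 * s3 ^ 2 * (1 - c1 ^ 2 * c2 ^ 2) : ℝ) : ℂ) := by
  have e : (((x * y) ^ 2 * s3 ^ 2 * (1 - c1 ^ 2 * c2 ^ 2) : ℝ) : ℂ)
      = (((x * y) ^ 2 * s3 ^ 2 * ((c1 ^ 2 + s1 ^ 2) * (c2 ^ 2 + s2 ^ 2) - c1 ^ 2 * c2 ^ 2) : ℝ) : ℂ)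
        * (ζ * star ζ) := by
    rw [h, h1, h2]; simp
  rw [e]
  simp [ghzForm, rho3, Matrix.det_fin_two, Fin.sum_univ_two]
  ring

lemma ghz_covB : covB (ghzForm x y c1 c2 c3 s1 s2 s3 ζ)
    = ((x * y * s2 * s3 : ℝ) * ζ : ℂ) • !![2 * (c1 : ℂ), s1; s1, 0] := by
  ext i j
  fin_cases i <;> fin_cases j <;> simp [covB, ghzForm] <;> ring

lemma ghz_invK (h : ζ * star ζ = 1) (h1 : c1 ^ 2 + s1 ^ 2 = 1) (h2 : c2 ^ 2 + s2 ^ 2 = 1)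
    (h3 : c3 ^ 2 + s3 ^ 2 = 1) :
    invK (ghzForm x y c1 c2 c3 s1 s2 s3 ζ)
      = (((x * y * s2 * s3) ^ 2 * ((1 + 3 * c1 ^ 2) * (x ^ 2 + y ^ 2)
        + 2 * (x * y) * (c1 * c2 * c3) * (3 + c1 ^ 2) * ζ.re) : ℝ) : ℂ) := by
  have hre : ζ + star ζ = ((2 * ζ.re : ℝ) : ℂ) := Complex.add_conj ζ
  have g1 : (s1 : ℂ) ^ 2 = 1 - (c1 : ℂ) ^ 2 := by
    have : (c1 : ℂ) ^ 2 + (s1 : ℂ) ^ 2 = 1 := by exact_mod_cast h1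
    linear_combination this
  have g2 : (c2 : ℂ) ^ 2 + (s2 : ℂ) ^ 2 = 1 := by exact_mod_cast h2
  have g3 : (c3 : ℂ) ^ 2 + (s3 : ℂ) ^ 2 = 1 := by exact_mod_cast h3
  have r00 : rho1 (ghzForm x y c1 c2 c3 s1 s2 s3 ζ) 0 0
      = x ^ 2 + y ^ 2 * c1 ^ 2 + x * y * (c1 * c2 * c3) * (ζ + star ζ) := by
    have e : (y : ℂ) ^ 2 * c1 ^ 2 = y ^ 2 * c1 ^ 2 * (ζ * star ζ)
      * (((c2 : ℂ) ^ 2 + (s2 : ℂ) ^ 2) * ((c3 : ℂ) ^ 2 + (s3 : ℂ) ^ 2)) := by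
      rw [h, g2, g3]; ring
    rw [e]
    simp [ghzForm, rho1, Fin.sum_univ_two]
    ring
  have r01 : rho1 (ghzForm x y c1 c2 c3 s1 s2 s3 ζ) 0 1
      = y ^ 2 * c1 * s1 + x * y * (s1 * c2 * c3) * star ζ := by
    have e : (y : ℂ) ^ 2 * c1 * s1 = y ^ 2 * c1 * s1 * (ζ * star ζ)
      * (((c2 : ℂ) ^ 2 + (s2 : ℂ) ^ 2) * ((c3 : ℂ) ^ 2 + (s3 : ℂ) ^ 2)) := by
      rw [h, g2, g3]; ring
    rw [e]
    simp [ghzForm, rho1, Fin.sum_univ_two]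
    ring
  have r10 : rho1 (ghzForm x y c1 c2 c3 s1 s2 s3 ζ) 1 0
      = y ^ 2 * c1 * s1 + x * y * (s1 * c2 * c3) * ζ := by
    have e : (y : ℂ) ^ 2 * c1 * s1 = y ^ 2 * c1 * s1 * (ζ * star ζ)
      * (((c2 : ℂ) ^ 2 + (s2 : ℂ) ^ 2) * ((c3 : ℂ) ^ 2 + (s3 : ℂ) ^ 2)) := by
      rw [h, g2, g3]; ring
    rw [e]
    simp [ghzForm, rho1, Fin.sum_univ_two]
    ring
  have r11 : rho1 (ghzForm x y c1 c2 c3 s1 s2 s3 ζ) 1 1 = y ^ 2 * s1 ^ 2 := by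
    have e : (y : ℂ) ^ 2 * s1 ^ 2 = y ^ 2 * s1 ^ 2 * (ζ * star ζ)
      * (((c2 : ℂ) ^ 2 + (s2 : ℂ) ^ 2) * ((c3 : ℂ) ^ 2 + (s3 : ℂ) ^ 2)) := by
      rw [h, g2, g3]; ring
    rw [e]
    simp [ghzForm, rho1, Fin.sum_univ_two]
    ring
  have eB : covB (ghzForm x y c1 c2 c3 s1 s2 s3 ζ)
      * (covB (ghzForm x y c1 c2 c3 s1 s2 s3 ζ)).conjTranspose
      = ((x * y * s2 * s3 : ℂ) ^ 2) •
        !![4 * (c1 : ℂ) ^ 2 + s1 ^ 2, 2 * (c1 : ℂ) * s1; 2 * (c1 : ℂ) * s1, (s1 : ℂ) ^ 2] := by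
    rw [ghz_covB, Matrix.conjTranspose_smul, Matrix.smul_mul, Matrix.mul_smul, smul_smul]
    have : ((x * y * s2 * s3 : ℝ) * ζ : ℂ) * star ((x * y * s2 * s3 : ℝ) * ζ : ℂ)
        = (x * y * s2 * s3 : ℂ) ^ 2 := by
      rw [star_mul', show star ((x * y * s2 * s3 : ℝ) : ℂ) = ((x * y * s2 * s3 : ℝ) : ℂ) from Complex.conj_ofReal _]
      push_cast
      linear_combination ((x * y * s2 * s3 : ℂ) ^ 2) * h
    rw [this]
    congr 1
    ext i j
    fin_cases i <;> fin_cases j <;> simp [Matrix.mul_apply, Fin.sum_univ_two, Complex.conj_ofNat] <;> ring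
  rw [invK, eB, Matrix.trace_fin_two]
  simp only [Matrix.mul_apply, Fin.sum_univ_two, r00, r01, r10, r11, Matrix.smul_apply]
  simp only [Matrix.of_apply, Matrix.cons_val_zero, Matrix.cons_val_one, smul_eq_mul, Matrix.cons_val']
  push_cast
  push_cast at hre
  generalize star ζ = η at *
  obtain rfl : η = 2 * (ζ.re : ℂ) - ζ := by linear_combination hre
  have g14 : (s1 : ℂ) ^ 4 = (1 - (c1 : ℂ) ^ 2) ^ 2 := by rw [← g1]; ring
  ring_nf
  simp only [g1, g14]
  ring

end

lemma aux_det_herm (M : Matrix (Fin 2) (Fin 2) ℂ) (hM : ∀ i j, star (M j i) = M i j)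
    (ht : M 0 0 + M 1 1 = 1) : M.det = ((minEig M * (1 - minEig M) : ℝ) : ℂ) := by
  obtain ⟨x, hx⟩ := Complex.conj_eq_iff_real.1 (hM 0 0)
  exact aux_det_eq M ht x hx (hM 1 0).symm

lemma rho1_tr (v : H3) : rho1 v 0 0 + rho1 v 1 1 = (normSq3 v : ℂ) := by
  rw [normSq3_cast]
  simp only [rho1, Matrix.of_apply, Fin.sum_univ_two]

lemma rho2_tr (v : H3) : rho2 v 0 0 + rho2 v 1 1 = (normSq3 v : ℂ) := by
  rw [normSq3_cast]
  simp only [rho2, Matrix.of_apply, Fin.sum_univ_two]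
  ring

lemma rho3_tr (v : H3) : rho3 v 0 0 + rho3 v 1 1 = (normSq3 v : ℂ) := by
  rw [normSq3_cast]
  simp only [rho3, Matrix.of_apply, Fin.sum_univ_two]
  ring

lemma rho1_herm (v : H3) (i j : Fin 2) : star (rho1 v j i) = rho1 v i j := by
  simp only [rho1, Matrix.of_apply, Fin.sum_univ_two, star_add, star_mul, star_star]

lemma rho2_herm (v : H3) (i j : Fin 2) : star (rho2 v j i) = rho2 v i j := by
  simp only [rho2, Matrix.of_apply, Fin.sum_univ_two, star_add, star_mul, star_star]

lemma rho3_herm (v : H3) (i j : Fin 2) : star (rho3 v j i) = rho3 v i j := by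
  simp only [rho3, Matrix.of_apply, Fin.sum_univ_two, star_add, star_mul, star_star]

/-- for local spectra in the interior of the Kirwan polytope there is an
uncountable family of pairwise LU-inequivalent unit vectors with those local spectra. -/
theorem uncountably_many_LU_classes_in_interior_of_Kirwan_polytope
    (v : H3) (hv : normSq3 v = 1)
    (hlt1 : p1 v < 1 / 2) (hlt2 : p2 v < 1 / 2) (hlt3 : p3 v < 1 / 2)
    (hpoly1 : p1 v < p2 v + p3 v) (hpoly2 : p2 v < p1 v + p3 v)
    (hpoly3 : p3 v < p1 v + p2 v) :
    ∃ S : Set H3, ¬ S.Countable ∧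
      (∀ w ∈ S, normSq3 w = 1 ∧ p1 w = p1 v ∧ p2 w = p2 v ∧ p3 w = p3 v) ∧
      (∀ w ∈ S, ∀ w' ∈ S, w ≠ w' → ¬ LUequiv w w') := by
  have D1 := aux_det_herm _ (rho1_herm v) (by rw [rho1_tr, hv]; simp)
  have D2 := aux_det_herm _ (rho2_herm v) (by rw [rho2_tr, hv]; simp)
  have D3 := aux_det_herm _ (rho3_herm v) (by rw [rho3_tr, hv]; simp)
  obtain ⟨t, e1, e2, e3, t0, l1, l2, l3, f1, f2, f3, hQ⟩ :=
    aux_exists_t (p1 v) (p2 v) (p3 v) hlt1 hlt2 hlt3 hpoly1 hpoly2 hpoly3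
  obtain ⟨q, c1, c2, c3, s1, s2, s3, q0, c10, c20, c30, s10, s20, s30, n1, n2, n3,
    d1, d2, d3, hlt⟩ := aux_params _ _ _ t e1 e2 e3 t0 l1 l2 l3 f1 f2 f3 hQ
  obtain ⟨κ, hκ⟩ : ∃ κ, κ = c1 * c2 * c3 := ⟨_, rfl⟩
  have κ0 : 0 < κ := by rw [hκ]; positivity
  rw [← hκ] at hlt
  -- upper end of the interval of cosines
  obtain ⟨m, hm⟩ : ∃ m, m = min 1 ((1 - 2 * q) / (2 * q * κ)) := ⟨_, rfl⟩
  have hm1 : -1 < m := by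
    rw [hm, lt_min_iff]
    refine ⟨by norm_num, ?_⟩
    rw [lt_div_iff₀ (by positivity)]
    linarith
  have hz1 : ∀ z ∈ Set.Ioo (-1) m, z < 1 := fun z hz =>
    lt_of_lt_of_le hz.2 (hm ▸ min_le_left _ _)
  have hz2 : ∀ z ∈ Set.Ioo (-1) m, 2 * q * κ * z < 1 - 2 * q := fun z hz => by
    have h := lt_of_lt_of_le hz.2 (hm ▸ min_le_right _ _ : m ≤ (1 - 2 * q) / (2 * q * κ))
    rw [lt_div_iff₀ (by positivity)] at h
    linarith
  have main : ∀ z ∈ Set.Ioo (-1) m, ∃ w : H3,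
      (normSq3 w = 1 ∧ p1 w = p1 v ∧ p2 w = p2 v ∧ p3 w = p3 v) ∧
      invK w = (((q * s2 * s3) ^ 2 * (1 + 3 * c1 ^ 2)
        + (4 * (q * s2 * s3) ^ 2 * q * κ * s1 ^ 2) * z : ℝ) : ℂ) := by
    intro z hz
    have b1 := hz1 z hz
    have b2 := hz2 z hz
    have b3 := hz.1
    obtain ⟨T, hT⟩ : ∃ T, T = 1 - 2 * q * κ * z := ⟨_, rfl⟩
    obtain ⟨a, ha⟩ : ∃ a, a ^ 2 = T + 2 * q := ⟨√(T + 2 * q), Real.sq_sqrt (by linarith)⟩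
    obtain ⟨b, hb⟩ : ∃ b, b ^ 2 = T - 2 * q := ⟨√(T - 2 * q), Real.sq_sqrt (by linarith)⟩
    obtain ⟨u, hu⟩ : ∃ u, u ^ 2 = 1 - z ^ 2 := ⟨√(1 - z ^ 2), Real.sq_sqrt (by nlinarith)⟩
    obtain ⟨x, hx⟩ : ∃ x, x = (a + b) / 2 := ⟨_, rfl⟩
    obtain ⟨y, hy⟩ : ∃ y, y = (a - b) / 2 := ⟨_, rfl⟩
    have hxy : x * y = q := by rw [hx, hy]; linear_combination ha / 4 - hb / 4
    have hxy2 : x ^ 2 + y ^ 2 = T := by rw [hx, hy]; linear_combination ha / 2 + hb / 2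
    obtain ⟨ζ, hζ⟩ : ∃ ζ : ℂ, ζ = ⟨z, u⟩ := ⟨_, rfl⟩
    have hre : ζ.re = z := by rw [hζ]
    have hζ1 : ζ * star ζ = 1 := by
      have : ζ * star ζ = (Complex.normSq ζ : ℂ) := Complex.mul_conj ζ
      rw [this, hζ, Complex.normSq_mk]
      have : z * z + u * u = 1 := by linear_combination hu
      rw [this]; simp
    have hnorm : normSq3 (ghzForm x y c1 c2 c3 s1 s2 s3 ζ) = 1 := by
      rw [ghz_norm x y c1 c2 c3 s1 s2 s3 ζ hζ1 n1 n2 n3, hxy2, hxy, hre, ← hκ, hT]; ring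
    refine ⟨ghzForm x y c1 c2 c3 s1 s2 s3 ζ, ⟨hnorm, ?_, ?_, ?_⟩, ?_⟩
    · apply aux_minEig_congr
      · rw [rho1_tr, rho1_tr, hnorm, hv]
      · rw [ghz_det1 x y c1 c2 c3 s1 s2 s3 ζ hζ1 n2 n3, D1, hxy, d1]; rfl
    · apply aux_minEig_congr
      · rw [rho2_tr, rho2_tr, hnorm, hv]
      · rw [ghz_det2 x y c1 c2 c3 s1 s2 s3 ζ hζ1 n1 n3, D2, hxy, d2]; rfl
    · apply aux_minEig_congr
      · rw [rho3_tr, rho3_tr, hnorm, hv]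
      · rw [ghz_det3 x y c1 c2 c3 s1 s2 s3 ζ hζ1 n1 n2, D3, hxy, d3]; rfl
    · rw [ghz_invK x y c1 c2 c3 s1 s2 s3 ζ hζ1 n1 n2 n3, hxy2, hxy, hre, ← hκ, hT]
      congr 1
      have : s1 ^ 2 = 1 - c1 ^ 2 := by linarith
      rw [this]; ring
  choose! W hW1 hW2 using main
  have β0 : 4 * (q * s2 * s3) ^ 2 * q * κ * s1 ^ 2 ≠ 0 := by positivity
  have hinj : ∀ z ∈ Set.Ioo (-1) m, ∀ z' ∈ Set.Ioo (-1) m, invK (W z) = invK (W z') → z = z' := by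
    intro z hz z' hz' h
    rw [hW2 z hz, hW2 z' hz'] at h
    have h := Complex.ofReal_injective h
    exact mul_left_cancel₀ β0 (by linarith)
  refine ⟨W '' Set.Ioo (-1) m, ?_, ?_, ?_⟩
  · intro hc
    have hWi : Set.InjOn W (Set.Ioo (-1) m) := fun z hz z' hz' h => hinj z hz z' hz' (by rw [h])
    have := (Set.countable_of_injective_of_countable_image hWi hc)
    exact (Cardinal.Real.Ioo_countable_iff.1 this).not_gt hm1
  · rintro _ ⟨z, hz, rfl⟩
    exact hW1 z hz
  · rintro _ ⟨z, hz, rfl⟩ _ ⟨z', hz', rfl⟩ hne hLU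
    exact hne (by rw [hinj z' hz' z hz (invK_LU _ _ hLU)])
end
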